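/- arXiv:2408.08233 — 5 statements merged into one kernel-verified Lean document; each statement's English description precedes it below -/
import Mathlib

section
/- Existence of optimal couplings: Let (Z, d_Z) be a separable metric space, p ∈ [1,∞), and let X = (X, ω_X, μ_X) and Y = (Y, ω_Y, μ_Y) be (Z,p)-networks. Then there exists a coupling π ∈ C(μ_X, μ_Y) achieving the infimum defining the Z-Gromov–Wasserstein distance, i.e. GW_p^Z(X,Y) = (1/2) dis_p^Z(π). -/
open MeasureTheory

noncomputable section

/-- The set of couplings of two measures: probability measures on the product
whose marginals are `μ` and `ν`. -/
def Couplings {X Y : Type*} [MeasurableSpace X] [MeasurableSpace Y]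
    (μ : Measure X) (ν : Measure Y) : Set (Measure (X × Y)) :=
  {π | IsProbabilityMeasure π ∧ π.map Prod.fst = μ ∧ π.map Prod.snd = ν}

/-- The `p`-distortion of a coupling `π`, for kernels `ωX`, `ωY` valued in a
(pseudo)metric space `Z`. -/
def dis {X Y Z : Type*} [MeasurableSpace X] [MeasurableSpace Y] [PseudoMetricSpace Z]
    (p : ℝ) (ωX : X × X → Z) (ωY : Y × Y → Z) (π : Measure (X × Y)) : ℝ :=
  (∫ w : X × Y, ∫ w' : X × Y,
      dist (ωX (w.1, w'.1)) (ωY (w.2, w'.2)) ^ p ∂π ∂π) ^ (1 / p)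

/-- The `Z`-Gromov–Wasserstein `p`-distance between `(X, ωX, μX)` and `(Y, ωY, μY)`. -/
def GW {X Y Z : Type*} [MeasurableSpace X] [MeasurableSpace Y] [PseudoMetricSpace Z]
    (p : ℝ) (ωX : X × X → Z) (μX : Measure X) (ωY : Y × Y → Z) (μY : Measure Y) : ℝ :=
  (1 / 2) * sInf (dis p ωX ωY '' Couplings μX μY)

/-- `(X, ω, μ)` is a `(Z,p)`-network: `μ` is a Borel probability measure, `ω` is Borel
measurable, and `∬ d_Z(ω(x,x'), z₀)^p dμ dμ < ∞` for some `z₀`. -/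
structure IsNetwork {X Z : Type*} [MeasurableSpace X] [MeasurableSpace Z] [PseudoMetricSpace Z]
    (p : ℝ) (ω : X × X → Z) (μ : Measure X) : Prop where
  prob : IsProbabilityMeasure μ
  meas : Measurable ω
  integ : ∃ z₀ : Z, (∫⁻ x, ∫⁻ x', ENNReal.ofReal (dist (ω (x, x')) z₀ ^ p) ∂μ ∂μ) < ⊤

open Filter Topology Set

/-- Along a weakly convergent sequence of measures with fixed marginals, the mass of a countable
union of measurable rectangles is lower semicontinuous. -/
theorem measure_iUnion_prod_le_liminf {A B ι : Type*} [Countable ι]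
    [MeasurableSpace A] [TopologicalSpace A] [PolishSpace A] [BorelSpace A]
    [MeasurableSpace B] [TopologicalSpace B] [PolishSpace B] [BorelSpace B]
    {P : Measure A} {Q : Measure B} [IsFiniteMeasure P] [IsFiniteMeasure Q]
    {σ : ProbabilityMeasure (A × B)} {σs : ℕ → ProbabilityMeasure (A × B)}
    (hlim : Tendsto σs atTop (𝓝 σ))
    (h_fst : ∀ n, (σs n : Measure (A × B)).map Prod.fst = P)
    (h_snd : ∀ n, (σs n : Measure (A × B)).map Prod.snd = Q)
    {S : ι → Set A} {T : ι → Set B}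
    (hS : ∀ i, MeasurableSet (S i)) (hT : ∀ i, MeasurableSet (T i)) :
    (σ : Measure (A × B)) (⋃ i, S i ×ˢ T i) ≤
      liminf (fun n ↦ (σs n : Measure (A × B)) (⋃ i, S i ×ˢ T i)) atTop := by
  refine ENNReal.le_of_forall_pos_le_add fun ε hε _ ↦ ?_
  obtain ⟨δ, hδ, hsum⟩ := ENNReal.exists_pos_sum_of_countable'
    (ε := (ε : ENNReal) / 2) (by simpa using hε.ne') ι
  choose U hSU hU _ hUδ using fun i ↦
    (hS i).exists_isOpen_sdiff_lt (measure_ne_top P _) (hδ i).ne'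
  choose V hTV hV _ hVδ using fun i ↦
    (hT i).exists_isOpen_sdiff_lt (measure_ne_top Q _) (hδ i).ne'
  have hbound (n : ℕ) : (σs n : Measure (A × B)) (⋃ i, U i ×ˢ V i) ≤
      (σs n : Measure (A × B)) (⋃ i, S i ×ˢ T i) + ε := by
    have hsub : (⋃ i, U i ×ˢ V i) ⊆ (⋃ i, S i ×ˢ T i) ∪
        ((⋃ i, Prod.fst ⁻¹' (U i \ S i)) ∪ ⋃ i, Prod.snd ⁻¹' (V i \ T i)) := by
      intro w hw
      obtain ⟨i, hi⟩ := mem_iUnion.1 hw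
      by_cases h1 : w.1 ∈ S i
      · by_cases h2 : w.2 ∈ T i
        · exact Or.inl (mem_iUnion.2 ⟨i, h1, h2⟩)
        · exact Or.inr (Or.inr (mem_iUnion.2 ⟨i, hi.2, h2⟩))
      · exact Or.inr (Or.inl (mem_iUnion.2 ⟨i, hi.1, h1⟩))
    have hfst : (σs n : Measure (A × B)) (⋃ i, Prod.fst ⁻¹' (U i \ S i)) ≤ (ε : ENNReal) / 2 := by
      refine (measure_iUnion_le _).trans ((ENNReal.tsum_le_tsum fun i ↦ ?_).trans hsum.le)
      rw [← Measure.map_apply measurable_fst ((hU i).measurableSet.diff (hS i)), h_fst]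
      exact (hUδ i).le
    have hsnd : (σs n : Measure (A × B)) (⋃ i, Prod.snd ⁻¹' (V i \ T i)) ≤ (ε : ENNReal) / 2 := by
      refine (measure_iUnion_le _).trans ((ENNReal.tsum_le_tsum fun i ↦ ?_).trans hsum.le)
      rw [← Measure.map_apply measurable_snd ((hV i).measurableSet.diff (hT i)), h_snd]
      exact (hVδ i).le
    calc _ ≤ _ := measure_mono hsub
      _ ≤ _ := measure_union_le _ _
      _ ≤ _ := add_le_add_right (measure_union_le _ _) _
      _ ≤ _ := add_le_add_right (add_le_add hfst hsnd) _
      _ = _ := by rw [ENNReal.add_halves]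
  calc (σ : Measure (A × B)) (⋃ i, S i ×ˢ T i)
      ≤ (σ : Measure (A × B)) (⋃ i, U i ×ˢ V i) :=
        measure_mono (iUnion_mono fun i ↦ prod_mono (hSU i) (hTV i))
    _ ≤ liminf (fun n ↦ (σs n : Measure (A × B)) (⋃ i, U i ×ˢ V i)) atTop :=
        ProbabilityMeasure.le_liminf_measure_open_of_tendsto hlim
          (isOpen_iUnion fun i ↦ (hU i).prod (hV i))
    _ ≤ liminf (fun n ↦ (σs n : Measure (A × B)) (⋃ i, S i ×ˢ T i) + ε) atTop :=
        liminf_le_liminf (Eventually.of_forall hbound)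
    _ = _ := liminf_add_const _ _ _ (by isBoundedDefault) (by isBoundedDefault)

/-- Lower semicontinuity of `σ ↦ ∫ c(f(a), g(b)) dσ` along weakly convergent couplings with fixed
marginals, where `f` and `g` are merely measurable and `c ≥ 0` is continuous. -/
theorem lintegral_comp_le_liminf_of_marginals {A B Z W : Type*}
    [MeasurableSpace A] [TopologicalSpace A] [PolishSpace A] [BorelSpace A]
    [MeasurableSpace B] [TopologicalSpace B] [PolishSpace B] [BorelSpace B]
    [TopologicalSpace Z] [SecondCountableTopology Z] [MeasurableSpace Z] [BorelSpace Z]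
    [TopologicalSpace W] [SecondCountableTopology W] [MeasurableSpace W] [BorelSpace W]
    {P : Measure A} {Q : Measure B} [IsFiniteMeasure P] [IsFiniteMeasure Q]
    {σ : ProbabilityMeasure (A × B)} {σs : ℕ → ProbabilityMeasure (A × B)}
    (hlim : Tendsto σs atTop (𝓝 σ))
    (h_fst : ∀ n, (σs n : Measure (A × B)).map Prod.fst = P)
    (h_snd : ∀ n, (σs n : Measure (A × B)).map Prod.snd = Q)
    {f : A → Z} {g : B → W} (hf : Measurable f) (hg : Measurable g)
    {c : Z × W → ℝ} (hc : Continuous c) (hc0 : 0 ≤ c) :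
    ∫⁻ w, ENNReal.ofReal (c (f w.1, g w.2)) ∂(σ : Measure (A × B)) ≤
      liminf (fun n ↦ ∫⁻ w, ENNReal.ofReal (c (f w.1, g w.2)) ∂(σs n : Measure (A × B)))
        atTop := by
  have hfg : Measurable (Prod.map f g) := hf.prodMap hg
  have hcm : Measurable fun z ↦ ENNReal.ofReal (c z) := hc.measurable.ennreal_ofReal
  have key := lintegral_le_liminf_lintegral_of_forall_isOpen_measure_le_liminf_measure
    (μ := (σ : Measure (A × B)).map (Prod.map f g))
    (μs := fun n ↦ (σs n : Measure (A × B)).map (Prod.map f g)) hc hc0 ?_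
  · simpa only [lintegral_map hcm hfg] using! key
  intro G hG
  simp_rw [Measure.map_apply hfg hG.measurableSet]
  have hZ := TopologicalSpace.isBasis_countableBasis Z
  have hW := TopologicalSpace.isBasis_countableBasis W
  obtain ⟨R, hR, rfl⟩ := (hZ.prod hW).open_eq_sUnion hG
  have hRc : R.Countable := ((TopologicalSpace.countable_countableBasis Z).image2
    (TopologicalSpace.countable_countableBasis W) _).mono hR
  have : Countable R := hRc.to_subtype
  choose u hu v hv huv using fun r : R ↦ hR r.2
  have heq : Prod.map f g ⁻¹' ⋃₀ R = ⋃ r : R, (f ⁻¹' u r) ×ˢ (g ⁻¹' v r) := by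
    rw [sUnion_eq_iUnion, preimage_iUnion]
    refine iUnion_congr fun r ↦ ?_
    rw [← huv r]
    rfl
  rw [heq]
  exact measure_iUnion_prod_le_liminf hlim h_fst h_snd
    (fun r ↦ hf (hZ.isOpen (hu r)).measurableSet) (fun r ↦ hg (hW.isOpen (hv r)).measurableSet)

/-- The set of couplings of two Borel probability measures on Polish spaces is weakly compact. -/
theorem isCompact_setOf_mem_couplings {X Y : Type*}
    [MeasurableSpace X] [TopologicalSpace X] [PolishSpace X] [BorelSpace X]
    [MeasurableSpace Y] [TopologicalSpace Y] [PolishSpace Y] [BorelSpace Y]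
    (μ : Measure X) (ν : Measure Y) [IsProbabilityMeasure μ] [IsProbabilityMeasure ν] :
    IsCompact {π : ProbabilityMeasure (X × Y) | (π : Measure (X × Y)) ∈ Couplings μ ν} := by
  set K := {π : ProbabilityMeasure (X × Y) | (π : Measure (X × Y)) ∈ Couplings μ ν}
  have hclosed : IsClosed K := by
    have hK : K = (fun π : ProbabilityMeasure (X × Y) ↦
          π.map (continuous_fst.measurable.aemeasurable)) ⁻¹' {⟨μ, inferInstance⟩} ∩
        (fun π : ProbabilityMeasure (X × Y) ↦
          π.map (continuous_snd.measurable.aemeasurable)) ⁻¹' {⟨ν, inferInstance⟩} := by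
      ext π
      constructor
      · rintro ⟨-, h1, h2⟩
        exact ⟨Subtype.ext h1, Subtype.ext h2⟩
      · rintro ⟨h1, h2⟩
        exact ⟨inferInstance, congrArg Subtype.val h1, congrArg Subtype.val h2⟩
    rw [hK]
    exact (isClosed_singleton.preimage (ProbabilityMeasure.continuous_map continuous_fst)).inter
      (isClosed_singleton.preimage (ProbabilityMeasure.continuous_map continuous_snd))
  rw [← hclosed.closure_eq]
  refine isCompact_closure_of_isTightMeasureSet (IsTightMeasureSet.prodMk ?_ ?_)
  · refine (isTightMeasureSet_singleton (μ := μ)).subset ?_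
    rintro _ ⟨_, ⟨π, hπ, rfl⟩, rfl⟩
    exact hπ.2.1
  · refine (isTightMeasureSet_singleton (μ := ν)).subset ?_
    rintro _ ⟨_, ⟨π, hπ, rfl⟩, rfl⟩
    exact hπ.2.2

/-- The marginals of `π ⊗ π`, regarded as a measure on `(X × X) × (Y × Y)`. -/
theorem map_prodProdProdComm_mem_couplings {X Y : Type*} [MeasurableSpace X] [MeasurableSpace Y]
    {μ : Measure X} {ν : Measure Y} {π : Measure (X × Y)} (hπ : π ∈ Couplings μ ν) :
    (π.prod π).map (Equiv.prodProdProdComm X Y X Y) ∈ Couplings (μ.prod μ) (ν.prod ν) := by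
  obtain ⟨_, rfl, rfl⟩ := hπ
  have hm : Measurable (Equiv.prodProdProdComm X Y X Y) :=
    (measurable_fst.prodMap measurable_fst).prodMk (measurable_snd.prodMap measurable_snd)
  refine ⟨Measure.isProbabilityMeasure_map hm.aemeasurable, ?_, ?_⟩
  · rw [Measure.map_map measurable_fst hm, Measure.map_prod_map _ _ measurable_fst measurable_fst]
    rfl
  · rw [Measure.map_map measurable_snd hm, Measure.map_prod_map _ _ measurable_snd measurable_snd]
    rfl

/-- The `p`-th power of the distortion of a coupling, as an extended nonnegative real. -/
def disLIntegral {X Y Z : Type*} [MeasurableSpace X] [MeasurableSpace Y] [PseudoMetricSpace Z]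
    (p : ℝ) (ωX : X × X → Z) (ωY : Y × Y → Z) (π : Measure (X × Y)) : ENNReal :=
  ∫⁻ w, ENNReal.ofReal (dist (ωX (w.1.1, w.2.1)) (ωY (w.1.2, w.2.2)) ^ p) ∂π.prod π

theorem disLIntegral_le_liminf {X Y Z : Type*}
    [MeasurableSpace X] [TopologicalSpace X] [PolishSpace X] [BorelSpace X]
    [MeasurableSpace Y] [TopologicalSpace Y] [PolishSpace Y] [BorelSpace Y]
    [PseudoMetricSpace Z] [SecondCountableTopology Z] [MeasurableSpace Z] [BorelSpace Z]
    {p : ℝ} (hp : 0 ≤ p) {ωX : X × X → Z} {ωY : Y × Y → Z}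
    (hωX : Measurable ωX) (hωY : Measurable ωY)
    {μ : Measure X} {ν : Measure Y} [IsFiniteMeasure μ] [IsFiniteMeasure ν]
    {π : ProbabilityMeasure (X × Y)} {πs : ℕ → ProbabilityMeasure (X × Y)}
    (hlim : Tendsto πs atTop (𝓝 π)) (hπs : ∀ n, (πs n : Measure (X × Y)) ∈ Couplings μ ν) :
    disLIntegral p ωX ωY (π : Measure (X × Y)) ≤
      liminf (fun n ↦ disLIntegral p ωX ωY (πs n : Measure (X × Y))) atTop := by
  have hcont : Continuous (Equiv.prodProdProdComm X Y X Y) :=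
    (continuous_fst.prodMap continuous_fst).prodMk (continuous_snd.prodMap continuous_snd)
  have hlim' := ((ProbabilityMeasure.continuous_map hcont).tendsto _).comp
    ((ProbabilityMeasure.continuous_prod.tendsto (π, π)).comp (hlim.prodMk_nhds hlim))
  have hc : Continuous fun z : Z × Z ↦ dist z.1 z.2 ^ p :=
    continuous_dist.rpow_const fun _ ↦ Or.inr hp
  have hm : Measurable fun w : (X × X) × (Y × Y) ↦
      ENNReal.ofReal (dist (ωX w.1) (ωY w.2) ^ p) :=
    (hc.measurable.comp (hωX.prodMap hωY)).ennreal_ofReal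
  have key := lintegral_comp_le_liminf_of_marginals hlim'
    (fun n ↦ (map_prodProdProdComm_mem_couplings (hπs n)).2.1)
    (fun n ↦ (map_prodProdProdComm_mem_couplings (hπs n)).2.2) hωX hωY hc
    (fun z ↦ Real.rpow_nonneg dist_nonneg p)
  simp only [Function.comp_def, ProbabilityMeasure.toMeasure_map,
    ProbabilityMeasure.toMeasure_prod, lintegral_map hm hcont.measurable] at key
  exact key

theorem IsNetwork.memLp_dist {X Z : Type*} [MeasurableSpace X] [MeasurableSpace Z]
    [PseudoMetricSpace Z] [OpensMeasurableSpace Z]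
    {p : ℝ} (hp : 0 < p) {ω : X × X → Z} {μ : Measure X} (h : IsNetwork p ω μ) :
    ∃ z₀, MemLp (fun x ↦ dist (ω x) z₀) (ENNReal.ofReal p) (μ.prod μ) := by
  have := h.prob
  obtain ⟨z₀, hz₀⟩ := h.integ
  have hm : Measurable fun x ↦ dist (ω x) z₀ :=
    (continuous_id.dist continuous_const).measurable.comp h.meas
  refine ⟨z₀, hm.aestronglyMeasurable, ?_⟩
  rw [eLpNorm_lt_top_iff_lintegral_rpow_enorm_lt_top (by simpa using hp) ENNReal.ofReal_ne_top,
    ENNReal.toReal_ofReal hp.le]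
  rw [← lintegral_prod (fun x ↦ ENNReal.ofReal (dist (ω x) z₀ ^ p))
    (hm.pow_const p).ennreal_ofReal.aemeasurable] at hz₀
  refine lt_of_eq_of_lt (lintegral_congr fun x ↦ ?_) hz₀
  rw [Real.enorm_of_nonneg dist_nonneg, ENNReal.ofReal_rpow_of_nonneg dist_nonneg hp.le]

theorem integrable_dist_rpow {X Y Z : Type*} [MeasurableSpace X] [MeasurableSpace Y]
    [PseudoMetricSpace Z] [SecondCountableTopology Z] [MeasurableSpace Z] [OpensMeasurableSpace Z]
    {p : ℝ} (hp : 0 < p) {ωX : X × X → Z} {μ : Measure X} (hX : IsNetwork p ωX μ)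
    {ωY : Y × Y → Z} {ν : Measure Y} (hY : IsNetwork p ωY ν)
    {π : Measure (X × Y)} (hπ : π ∈ Couplings μ ν) :
    Integrable (fun w : (X × Y) × (X × Y) ↦
      dist (ωX (w.1.1, w.2.1)) (ωY (w.1.2, w.2.2)) ^ p) (π.prod π) := by
  have := hπ.1
  have := hX.prob
  have := hY.prob
  obtain ⟨x₀, hx₀⟩ := hX.memLp_dist hp
  obtain ⟨y₀, hy₀⟩ := hY.memLp_dist hp
  have hfst : MeasurePreserving (Prod.map Prod.fst Prod.fst) (π.prod π) (μ.prod μ) :=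
    MeasurePreserving.prod ⟨measurable_fst, hπ.2.1⟩ ⟨measurable_fst, hπ.2.1⟩
  have hsnd : MeasurePreserving (Prod.map Prod.snd Prod.snd) (π.prod π) (ν.prod ν) :=
    MeasurePreserving.prod ⟨measurable_snd, hπ.2.2⟩ ⟨measurable_snd, hπ.2.2⟩
  have hm : Measurable fun w : (X × Y) × (X × Y) ↦
      dist (ωX (w.1.1, w.2.1)) (ωY (w.1.2, w.2.2)) :=
    (hX.meas.comp hfst.measurable).dist (hY.meas.comp hsnd.measurable)
  have hmem : MemLp (fun w : (X × Y) × (X × Y) ↦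
      dist (ωX (w.1.1, w.2.1)) (ωY (w.1.2, w.2.2))) (ENNReal.ofReal p) (π.prod π) := by
    refine (((hx₀.comp_measurePreserving hfst).add (hy₀.comp_measurePreserving hsnd)).add
      (memLp_const (dist x₀ y₀))).of_le hm.aestronglyMeasurable (Eventually.of_forall fun w ↦ ?_)
    refine le_trans ?_ (le_abs_self _)
    rw [Real.norm_of_nonneg dist_nonneg]
    have h1 := dist_triangle4 (ωX (w.1.1, w.2.1)) x₀ y₀ (ωY (w.1.2, w.2.2))
    rw [dist_comm y₀] at h1
    simp only [Pi.add_apply, Function.comp_apply, Prod.map]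
    linarith
  have key := hmem.integrable_norm_rpow (by simpa using hp) ENNReal.ofReal_ne_top
  simpa only [ENNReal.toReal_ofReal hp.le, Real.norm_of_nonneg dist_nonneg] using key

/-- **Existence of optimal couplings.** For `(Z,p)`-networks `X` and `Y` with `Z`
a separable metric space and `p ∈ [1,∞)`, there is a coupling `π` of `μX` and `μY`
with `GW_p^Z(X,Y) = (1/2) · dis_p^Z(π)`. -/
theorem exists_optimal_coupling
    {X Y Z : Type*}
    [MeasurableSpace X] [TopologicalSpace X] [PolishSpace X] [BorelSpace X]
    [MeasurableSpace Y] [TopologicalSpace Y] [PolishSpace Y] [BorelSpace Y]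
    [MetricSpace Z] [MeasurableSpace Z] [BorelSpace Z] [TopologicalSpace.SeparableSpace Z]
    (p : ℝ) (hp : 1 ≤ p)
    (ωX : X × X → Z) (μX : Measure X) (hX : IsNetwork p ωX μX)
    (ωY : Y × Y → Z) (μY : Measure Y) (hY : IsNetwork p ωY μY) :
    ∃ π ∈ Couplings μX μY, GW p ωX μX ωY μY = (1 / 2) * dis p ωX ωY π := by
  have := hX.prob
  have := hY.prob
  have : SecondCountableTopology Z := UniformSpace.secondCountable_of_separable Z
  have hp0 : 0 < p := by linarith
  set K := {π : ProbabilityMeasure (X × Y) | (π : Measure (X × Y)) ∈ Couplings μX μY}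
  set F := fun π : ProbabilityMeasure (X × Y) ↦ disLIntegral p ωX ωY (π : Measure (X × Y))
  have hprod : μX.prod μY ∈ Couplings μX μY :=
    ⟨inferInstance, by simp [Measure.map_fst_prod], by simp [Measure.map_snd_prod]⟩
  have hne : K.Nonempty := ⟨⟨μX.prod μY, hprod.1⟩, hprod⟩
  obtain ⟨u, -, hu, huK⟩ := exists_seq_tendsto_sInf (hne.image F) (OrderBot.bddBelow _)
  choose πs hπs hFπs using huK
  obtain ⟨π, hπ, φ, hφ, hlim⟩ := (isCompact_setOf_mem_couplings μX μY).isSeqCompact hπs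
  have hmin : F π ≤ sInf (F '' K) := by
    refine (disLIntegral_le_liminf hp0.le hX.meas hY.meas hlim fun n ↦ hπs (φ n)).trans_eq ?_
    refine Tendsto.liminf_eq ((hu.comp hφ.tendsto_atTop).congr fun n ↦ ?_)
    exact (hFπs (φ n)).symm
  have hdis {π : Measure (X × Y)} (hπ : π ∈ Couplings μX μY) :
      disLIntegral p ωX ωY π ≠ ⊤ ∧
        dis p ωX ωY π = (disLIntegral p ωX ωY π).toReal ^ (1 / p) := by
    have := hπ.1
    have hint := integrable_dist_rpow hp0 hX hY hπ
    refine ⟨hint.lintegral_lt_top.ne, ?_⟩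
    rw [dis, disLIntegral, ← integral_eq_lintegral_of_nonneg_ae
      (Eventually.of_forall fun _ ↦ Real.rpow_nonneg dist_nonneg p) hint.aestronglyMeasurable,
      integral_prod _ hint]
  refine ⟨π, hπ, ?_⟩
  suffices h : IsLeast (dis p ωX ωY '' Couplings μX μY) (dis p ωX ωY π) by
    rw [GW, h.csInf_eq]
  refine ⟨mem_image_of_mem _ hπ, ?_⟩
  rintro _ ⟨π', hπ', rfl⟩
  rw [(hdis hπ).2, (hdis hπ').2]
  have hle : disLIntegral p ωX ωY π ≤ disLIntegral p ωX ωY π' :=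
    hmin.trans (sInf_le ⟨⟨π', hπ'.1⟩, hπ', rfl⟩)
  exact Real.rpow_le_rpow ENNReal.toReal_nonneg (ENNReal.toReal_mono (hdis hπ').1 hle)
    (by positivity)
end
end

section
/- The Fused Network Gromov–Wasserstein distance satisfies the triangle inequality (and is symmetric and nonnegative): for all attributed networks X₁, X₂, X₃ with hyperparameter data H, one has FNGW_{q,α,β}(X₁, X₃) ≤ FNGW_{q,α,β}(X₁, X₂) + FNGW_{q,α,β}(X₂, X₃), and FNGW_{q,α,β}(X₁, X₂) = FNGW_{q,α,β}(X₂, X₁) ≥ 0. -/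
open MeasureTheory

noncomputable section

/-- The conditions for `(X, ψ, φ, ω, μ)` to be an attributed network with hyperparameter
data `H = (p, Ω, d_Ω, Ψ, d_Ψ)`. -/
structure IsAttrNetwork {X Ψ Ω : Type*} [MeasurableSpace X]
    [MeasurableSpace Ψ] [PseudoMetricSpace Ψ] [MeasurableSpace Ω] [PseudoMetricSpace Ω]
    (p : ℝ) (ψ : X → Ψ) (φ : X × X → ℝ) (ω : X × X → Ω) (μ : Measure X) : Prop where
  prob : IsProbabilityMeasure μ
  measψ : Measurable ψ
  measφ : Measurable φ
  measω : Measurable ω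
  integφ : (∫⁻ x, ∫⁻ x', ENNReal.ofReal (|φ (x, x')| ^ p) ∂μ ∂μ) < ⊤
  integψ : ∃ s₀ : Ψ, (∫⁻ x, ENNReal.ofReal (dist (ψ x) s₀ ^ p) ∂μ) < ⊤
  integω : ∃ u₀ : Ω, (∫⁻ x, ∫⁻ x', ENNReal.ofReal (dist (ω (x, x')) u₀ ^ p) ∂μ ∂μ) < ⊤

/-- The cost of a coupling `π` in the fused network Gromov–Wasserstein problem. -/
def FNGWcost {X Y Ψ Ω : Type*} [MeasurableSpace X] [MeasurableSpace Y]
    [PseudoMetricSpace Ψ] [PseudoMetricSpace Ω]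
    (p q α β : ℝ)
    (ψX : X → Ψ) (φX : X × X → ℝ) (ωX : X × X → Ω)
    (ψY : Y → Ψ) (φY : Y × Y → ℝ) (ωY : Y × Y → Ω)
    (π : Measure (X × Y)) : ℝ :=
  (∫ w : X × Y, ∫ w' : X × Y,
      ((1 - α - β) * dist (ψX w.1) (ψY w.2) ^ q
        + α * dist (ωX (w.1, w'.1)) (ωY (w.2, w'.2)) ^ q
        + β * |φX (w.1, w'.1) - φY (w.2, w'.2)| ^ q) ^ (p / q) ∂π ∂π) ^ (1 / p)

/-- The fused network Gromov–Wasserstein distance. -/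
def FNGW {X Y Ψ Ω : Type*} [MeasurableSpace X] [MeasurableSpace Y]
    [PseudoMetricSpace Ψ] [PseudoMetricSpace Ω]
    (p q α β : ℝ)
    (ψX : X → Ψ) (φX : X × X → ℝ) (ωX : X × X → Ω) (μX : Measure X)
    (ψY : Y → Ψ) (φY : Y × Y → ℝ) (ωY : Y × Y → Ω) (μY : Measure Y) : ℝ :=
  (1 / 2) * sInf (FNGWcost p q α β ψX φX ωX ψY φY ωY '' Couplings μX μY)

open ProbabilityTheory
open scoped ENNReal

/-- The weighted `ℓ^q` norm of a triple, with weights `1 - α - β`, `α`, `β`. -/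
def weightedLqNorm (q α β a b c : ℝ) : ℝ :=
  ((1 - α - β) * a ^ q + α * b ^ q + β * c ^ q) ^ (1 / q)

section WeightedLqNorm

variable {q α β : ℝ}

lemma weightedLqNorm_nonneg (hα : 0 ≤ α) (hβ : 0 ≤ β) (hαβ : α + β ≤ 1) {a b c : ℝ}
    (ha : 0 ≤ a) (hb : 0 ≤ b) (hc : 0 ≤ c) : 0 ≤ weightedLqNorm q α β a b c := by
  have : 0 ≤ 1 - α - β := by linarith
  unfold weightedLqNorm
  positivity

lemma weightedLqNorm_mono (hq : 1 ≤ q) (hα : 0 ≤ α) (hβ : 0 ≤ β) (hαβ : α + β ≤ 1)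
    {a b c a' b' c' : ℝ} (ha : 0 ≤ a) (hb : 0 ≤ b) (hc : 0 ≤ c)
    (haa' : a ≤ a') (hbb' : b ≤ b') (hcc' : c ≤ c') :
    weightedLqNorm q α β a b c ≤ weightedLqNorm q α β a' b' c' := by
  have : 0 ≤ 1 - α - β := by linarith
  have hq0 : 0 ≤ q := by linarith
  unfold weightedLqNorm
  gcongr

lemma weightedLqNorm_self (hq : 1 ≤ q) {a : ℝ} (ha : 0 ≤ a) :
    weightedLqNorm q α β a a a = a := by
  have h : (1 - α - β) * a ^ q + α * a ^ q + β * a ^ q = a ^ q := by ring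
  rw [weightedLqNorm, h, one_div, Real.rpow_rpow_inv ha (by linarith)]

lemma weightedLqNorm_le_add (hq : 1 ≤ q) (hα : 0 ≤ α) (hβ : 0 ≤ β) (hαβ : α + β ≤ 1)
    {a b c : ℝ} (ha : 0 ≤ a) (hb : 0 ≤ b) (hc : 0 ≤ c) :
    weightedLqNorm q α β a b c ≤ a + b + c :=
  (weightedLqNorm_mono hq hα hβ hαβ ha hb hc (by linarith) (by linarith) (by linarith)).trans_eq
    (weightedLqNorm_self hq (by positivity))

lemma weightedLqNorm_add_le (hq : 1 ≤ q) (hα : 0 ≤ α) (hβ : 0 ≤ β) (hαβ : α + β ≤ 1)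
    {a b c a' b' c' : ℝ} (ha : 0 ≤ a) (hb : 0 ≤ b) (hc : 0 ≤ c)
    (ha' : 0 ≤ a') (hb' : 0 ≤ b') (hc' : 0 ≤ c') :
    weightedLqNorm q α β (a + a') (b + b') (c + c')
      ≤ weightedLqNorm q α β a b c + weightedLqNorm q α β a' b' c' := by
  have hγ : 0 ≤ 1 - α - β := by linarith
  have hq0 : q ≠ 0 := by linarith
  have scale {w x : ℝ} (hw : 0 ≤ w) (hx : 0 ≤ x) : (w ^ q⁻¹ * x) ^ q = w * x ^ q := by
    rw [Real.mul_rpow (by positivity) hx, Real.rpow_inv_rpow hw hq0]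
  have hnonneg {x y z : ℝ} (hx : 0 ≤ x) (hy : 0 ≤ y) (hz : 0 ≤ z) :
      ∀ i ∈ Finset.univ, 0 ≤ ![(1 - α - β) ^ q⁻¹ * x, α ^ q⁻¹ * y, β ^ q⁻¹ * z] i := by
    intro i _
    fin_cases i <;> simp <;> positivity
  have key := Real.Lp_add_le_of_nonneg Finset.univ hq (hnonneg ha hb hc) (hnonneg ha' hb' hc')
  simp only [Fin.sum_univ_three, Matrix.cons_val_zero, Matrix.cons_val_one, Matrix.cons_val,
    ← mul_add] at key
  rwa [scale hγ (by positivity), scale hα (by positivity), scale hβ (by positivity),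
    scale hγ ha, scale hα hb, scale hβ hc, scale hγ ha', scale hα hb', scale hβ hc'] at key

end WeightedLqNorm

/-- The pointwise discrepancy whose `L^p(π ⊗ π)` norm is the cost of the coupling `π`. -/
def networkGap {X Y Ψ Ω : Type*} [PseudoMetricSpace Ψ] [PseudoMetricSpace Ω] (q α β : ℝ)
    (ψX : X → Ψ) (φX : X × X → ℝ) (ωX : X × X → Ω)
    (ψY : Y → Ψ) (φY : Y × Y → ℝ) (ωY : Y × Y → Ω) (z : (X × Y) × (X × Y)) : ℝ :=
  weightedLqNorm q α β (dist (ψX z.1.1) (ψY z.1.2))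
    (dist (ωX (z.1.1, z.2.1)) (ωY (z.1.2, z.2.2)))
    |φX (z.1.1, z.2.1) - φY (z.1.2, z.2.2)|

section NetworkGap

variable {X Y Z Ψ Ω : Type*} [PseudoMetricSpace Ψ] [PseudoMetricSpace Ω] {p q α β : ℝ}
  {ψX : X → Ψ} {φX : X × X → ℝ} {ωX : X × X → Ω}
  {ψY : Y → Ψ} {φY : Y × Y → ℝ} {ωY : Y × Y → Ω}
  {ψZ : Z → Ψ} {φZ : Z × Z → ℝ} {ωZ : Z × Z → Ω}

lemma networkGap_nonneg (hα : 0 ≤ α) (hβ : 0 ≤ β) (hαβ : α + β ≤ 1) (z : (X × Y) × (X × Y)) :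
    0 ≤ networkGap q α β ψX φX ωX ψY φY ωY z :=
  weightedLqNorm_nonneg hα hβ hαβ dist_nonneg dist_nonneg (abs_nonneg _)

lemma networkGap_triangle (hq : 1 ≤ q) (hα : 0 ≤ α) (hβ : 0 ≤ β) (hαβ : α + β ≤ 1)
    (x x' : X) (y y' : Y) (z z' : Z) :
    networkGap q α β ψX φX ωX ψZ φZ ωZ ((x, z), (x', z'))
      ≤ networkGap q α β ψX φX ωX ψY φY ωY ((x, y), (x', y'))
        + networkGap q α β ψY φY ωY ψZ φZ ωZ ((y, z), (y', z')) :=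
  (weightedLqNorm_mono hq hα hβ hαβ dist_nonneg dist_nonneg (abs_nonneg _)
    (dist_triangle _ (ψY y) _) (dist_triangle _ (ωY (y, y')) _)
    (abs_sub_le _ (φY (y, y')) _)).trans
  (weightedLqNorm_add_le hq hα hβ hαβ dist_nonneg dist_nonneg (abs_nonneg _)
    dist_nonneg dist_nonneg (abs_nonneg _))

variable [MeasurableSpace X] [MeasurableSpace Y]

lemma measurable_networkGap [MeasurableSpace Ψ] [OpensMeasurableSpace Ψ]
    [SecondCountableTopology Ψ] [MeasurableSpace Ω] [OpensMeasurableSpace Ω]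
    [SecondCountableTopology Ω]
    (hψX : Measurable ψX) (hφX : Measurable φX) (hωX : Measurable ωX)
    (hψY : Measurable ψY) (hφY : Measurable φY) (hωY : Measurable ωY) :
    Measurable (networkGap q α β ψX φX ωX ψY φY ωY) := by
  unfold networkGap weightedLqNorm
  have h₁ : Measurable fun z : (X × Y) × (X × Y) ↦ dist (ψX z.1.1) (ψY z.1.2) :=
    (hψX.comp (by fun_prop)).dist (hψY.comp (by fun_prop))
  have h₂ : Measurable fun z : (X × Y) × (X × Y) ↦
      dist (ωX (z.1.1, z.2.1)) (ωY (z.1.2, z.2.2)) :=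
    (hωX.comp (by fun_prop)).dist (hωY.comp (by fun_prop))
  fun_prop

lemma FNGWcost_nonneg (hα : 0 ≤ α) (hβ : 0 ≤ β) (hαβ : α + β ≤ 1) (π : Measure (X × Y)) :
    0 ≤ FNGWcost p q α β ψX φX ωX ψY φY ωY π := by
  have : 0 ≤ 1 - α - β := by linarith
  unfold FNGWcost
  refine Real.rpow_nonneg (integral_nonneg fun w ↦ integral_nonneg fun w' ↦ ?_) _
  positivity

lemma FNGWcost_map_swap (π : Measure (X × Y)) :
    FNGWcost p q α β ψY φY ωY ψX φX ωX (π.map Prod.swap) =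
      FNGWcost p q α β ψX φX ωX ψY φY ωY π := by
  have hswap : (Prod.swap : X × Y → Y × X) = MeasurableEquiv.prodComm := rfl
  simp only [FNGWcost, hswap, integral_map_equiv]
  simp only [MeasurableEquiv.prodComm, MeasurableEquiv.coe_mk, Equiv.prodComm_apply,
    Prod.fst_swap, Prod.snd_swap, dist_comm (ψY _), dist_comm (ωY _), abs_sub_comm (φY _)]

end NetworkGap

lemma dist_le_dist_add_dist_add_dist {M : Type*} [PseudoMetricSpace M] (a b c d : M) :
    dist a b ≤ dist a c + (dist c d + dist b d) := by
  rw [dist_comm b d, ← add_assoc]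
  exact dist_triangle4 _ _ _ _

lemma memLp_of_lintegral_ofReal_rpow_lt_top {Z : Type*} [MeasurableSpace Z] {μ : Measure Z}
    {p : ℝ} (hp : 0 < p) {f : Z → ℝ} (hf : AEStronglyMeasurable f μ)
    (h : ∫⁻ z, ENNReal.ofReal (|f z| ^ p) ∂μ < ⊤) : MemLp f (ENNReal.ofReal p) μ := by
  refine ⟨hf, ?_⟩
  rw [eLpNorm_lt_top_iff_lintegral_rpow_enorm_lt_top (by simpa using hp) ENNReal.ofReal_ne_top,
    ENNReal.toReal_ofReal hp.le]
  simpa only [Real.enorm_eq_ofReal_abs, ENNReal.ofReal_rpow_of_nonneg (abs_nonneg _) hp.le] using h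

section AttrNetwork

variable {X Ψ Ω : Type*} [MeasurableSpace X]
  [MeasurableSpace Ψ] [PseudoMetricSpace Ψ] [MeasurableSpace Ω] [PseudoMetricSpace Ω]
  {p : ℝ} {ψ : X → Ψ} {φ : X × X → ℝ} {ω : X × X → Ω} {μ : Measure X}

lemma IsAttrNetwork.memLp_dist_vertex [OpensMeasurableSpace Ψ]
    (h : IsAttrNetwork p ψ φ ω μ) (hp : 0 < p) :
    ∃ s, MemLp (fun x ↦ dist (ψ x) s) (ENNReal.ofReal p) μ := by
  obtain ⟨s, hs⟩ := h.integψ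
  have hm : Measurable fun x ↦ dist (ψ x) s :=
    (continuous_id.dist continuous_const).measurable.comp h.measψ
  refine ⟨s, memLp_of_lintegral_ofReal_rpow_lt_top hp hm.aestronglyMeasurable ?_⟩
  simpa only [abs_dist] using hs

lemma IsAttrNetwork.memLp_dist_edge [OpensMeasurableSpace Ω]
    (h : IsAttrNetwork p ψ φ ω μ) (hp : 0 < p) :
    ∃ u, MemLp (fun x ↦ dist (ω x) u) (ENNReal.ofReal p) (μ.prod μ) := by
  obtain ⟨u, hu⟩ := h.integω
  have := h.prob
  have hm : Measurable fun x ↦ dist (ω x) u :=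
    (continuous_id.dist continuous_const).measurable.comp h.measω
  refine ⟨u, memLp_of_lintegral_ofReal_rpow_lt_top hp hm.aestronglyMeasurable ?_⟩
  simp only [abs_dist]
  rwa [lintegral_prod _ (hm.pow_const p).ennreal_ofReal.aemeasurable]

lemma IsAttrNetwork.memLp_network (h : IsAttrNetwork p ψ φ ω μ) (hp : 0 < p) :
    MemLp φ (ENNReal.ofReal p) (μ.prod μ) := by
  have := h.prob
  have hm := h.measφ
  refine memLp_of_lintegral_ofReal_rpow_lt_top hp hm.aestronglyMeasurable ?_
  rw [lintegral_prod _ (by fun_prop)]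
  exact h.integφ

end AttrNetwork

section Couplings

variable {X Y Z : Type*} [MeasurableSpace X] [MeasurableSpace Y] [MeasurableSpace Z]
  {μ : Measure X} {ν : Measure Y} {ξ : Measure Z}

lemma prod_mem_couplings [IsProbabilityMeasure μ] [IsProbabilityMeasure ν] :
    μ.prod ν ∈ Couplings μ ν :=
  ⟨inferInstance, measurePreserving_fst.map_eq, measurePreserving_snd.map_eq⟩

lemma map_swap_mem_couplings {π : Measure (X × Y)} (hπ : π ∈ Couplings μ ν) :
    π.map Prod.swap ∈ Couplings ν μ := by
  obtain ⟨_, h₁, h₂⟩ := hπ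
  refine ⟨Measure.isProbabilityMeasure_map measurable_swap.aemeasurable, ?_, ?_⟩
  · rwa [Measure.map_map measurable_fst measurable_swap]
  · rwa [Measure.map_map measurable_snd measurable_swap]

/-- The gluing lemma: two couplings with a common marginal are marginals of a single measure. -/
lemma exists_gluing [StandardBorelSpace X] [Nonempty X] [StandardBorelSpace Z] [Nonempty Z]
    {π : Measure (X × Y)} {ρ : Measure (Y × Z)} (hπ : π ∈ Couplings μ ν)
    (hρ : ρ ∈ Couplings ν ξ) :
    ∃ γ : Measure (Y × X × Z), IsProbabilityMeasure γ ∧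
      γ.map (fun t ↦ (t.2.1, t.1)) = π ∧ γ.map (fun t ↦ (t.1, t.2.2)) = ρ := by
  have hπ' := map_swap_mem_couplings hπ
  obtain ⟨_, hπ₁, -⟩ := hπ'
  obtain ⟨_, hρ₁, -⟩ := hρ
  set σ := π.map Prod.swap with hσ
  have : IsProbabilityMeasure ν := by
    rw [← hρ₁]; exact Measure.isProbabilityMeasure_map measurable_fst.aemeasurable
  have hσd : ν ⊗ₘ σ.condKernel = σ := by
    rw [← hπ₁]; exact σ.disintegrate σ.condKernel
  have hρd : ν ⊗ₘ ρ.condKernel = ρ := by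
    rw [← hρ₁]; exact ρ.disintegrate ρ.condKernel
  refine ⟨ν ⊗ₘ (σ.condKernel ×ₖ ρ.condKernel), inferInstance, ?_, ?_⟩
  · have h : (ν ⊗ₘ (σ.condKernel ×ₖ ρ.condKernel)).map (Prod.map id Prod.fst) = σ := by
      rw [← Measure.compProd_map measurable_fst, ← Kernel.fst_eq, Kernel.fst_prod, hσd]
    have h' : (ν ⊗ₘ (σ.condKernel ×ₖ ρ.condKernel)).map (fun t ↦ (t.2.1, t.1))
        = σ.map Prod.swap :=
      (Measure.map_map measurable_swap (by fun_prop)).symm.trans (congrArg _ h)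
    rw [h', hσ, Measure.map_map measurable_swap measurable_swap]
    simp
  · have h : (ν ⊗ₘ (σ.condKernel ×ₖ ρ.condKernel)).map (Prod.map id Prod.snd) = ρ := by
      rw [← Measure.compProd_map measurable_snd, ← Kernel.snd_eq, Kernel.snd_prod, hρd]
    exact h

end Couplings

section Cost

variable {X Y Z Ψ Ω : Type*} [MeasurableSpace X] [MeasurableSpace Y] [MeasurableSpace Z]
  [PseudoMetricSpace Ψ] [MeasurableSpace Ψ] [OpensMeasurableSpace Ψ] [SecondCountableTopology Ψ]
  [PseudoMetricSpace Ω] [MeasurableSpace Ω] [OpensMeasurableSpace Ω] [SecondCountableTopology Ω]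
  {p q α β : ℝ}
  {ψX : X → Ψ} {φX : X × X → ℝ} {ωX : X × X → Ω} {μX : Measure X}
  {ψY : Y → Ψ} {φY : Y × Y → ℝ} {ωY : Y × Y → Ω} {μY : Measure Y}
  {ψZ : Z → Ψ} {φZ : Z × Z → ℝ} {ωZ : Z × Z → Ω} {μZ : Measure Z}

lemma memLp_networkGap (hp : 1 ≤ p) (hq : 1 ≤ q) (hα : 0 ≤ α) (hβ : 0 ≤ β) (hαβ : α + β ≤ 1)
    (hX : IsAttrNetwork p ψX φX ωX μX) (hY : IsAttrNetwork p ψY φY ωY μY)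
    {π : Measure (X × Y)} (hπ : π ∈ Couplings μX μY) :
    MemLp (networkGap q α β ψX φX ωX ψY φY ωY) (ENNReal.ofReal p) (π.prod π) := by
  have hp0 : 0 < p := by linarith
  obtain ⟨_, h₁, h₂⟩ := hπ
  have := hX.prob
  have := hY.prob
  have mX : MeasurePreserving Prod.fst π μX := ⟨measurable_fst, h₁⟩
  have mY : MeasurePreserving Prod.snd π μY := ⟨measurable_snd, h₂⟩
  have mfst : MeasurePreserving Prod.fst (π.prod π) π := measurePreserving_fst
  obtain ⟨s, hs⟩ := hX.memLp_dist_vertex hp0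
  obtain ⟨t, ht⟩ := hY.memLp_dist_vertex hp0
  obtain ⟨u, hu⟩ := hX.memLp_dist_edge hp0
  obtain ⟨v, hv⟩ := hY.memLp_dist_edge hp0
  have hs' := hs.comp_measurePreserving (mX.comp mfst)
  have ht' := ht.comp_measurePreserving (mY.comp mfst)
  have hu' := hu.comp_measurePreserving (mX.prod mX)
  have hv' := hv.comp_measurePreserving (mY.prod mY)
  have hfX := (hX.memLp_network hp0).norm.comp_measurePreserving (mX.prod mX)
  have hfY := (hY.memLp_network hp0).norm.comp_measurePreserving (mY.prod mY)
  have hst := memLp_const (p := ENNReal.ofReal p) (μ := π.prod π) (dist s t)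
  have huv := memLp_const (p := ENNReal.ofReal p) (μ := π.prod π) (dist u v)
  refine (((hs'.add (hst.add ht')).add (hu'.add (huv.add hv'))).add (hfX.add hfY)).mono'
    (measurable_networkGap hX.measψ hX.measφ hX.measω
      hY.measψ hY.measφ hY.measω).aestronglyMeasurable (ae_of_all _ fun z ↦ ?_)
  rw [Real.norm_of_nonneg (networkGap_nonneg hα hβ hαβ z)]
  refine (weightedLqNorm_le_add hq hα hβ hαβ dist_nonneg dist_nonneg (abs_nonneg _)).trans ?_
  exact add_le_add (add_le_add (dist_le_dist_add_dist_add_dist _ _ s t)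
    (dist_le_dist_add_dist_add_dist _ _ u v)) (abs_sub _ _)

lemma FNGWcost_eq_toReal_eLpNorm (hp : 1 ≤ p) (hq : 1 ≤ q)
    (hα : 0 ≤ α) (hβ : 0 ≤ β) (hαβ : α + β ≤ 1)
    (hX : IsAttrNetwork p ψX φX ωX μX) (hY : IsAttrNetwork p ψY φY ωY μY)
    {π : Measure (X × Y)} (hπ : π ∈ Couplings μX μY) :
    FNGWcost p q α β ψX φX ωX ψY φY ωY π =
      (eLpNorm (networkGap q α β ψX φX ωX ψY φY ωY) (ENNReal.ofReal p) (π.prod π)).toReal := by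
  have hp0 : 0 < p := by linarith
  have hγ : 0 ≤ 1 - α - β := by linarith
  have h := memLp_networkGap hp hq hα hβ hαβ hX hY hπ
  obtain ⟨_, -, -⟩ := hπ
  have hint := h.integrable_norm_rpow (by simpa using hp0) ENNReal.ofReal_ne_top
  have hpow (z : (X × Y) × (X × Y)) : ‖networkGap q α β ψX φX ωX ψY φY ωY z‖ ^ p =
      ((1 - α - β) * dist (ψX z.1.1) (ψY z.1.2) ^ q
        + α * dist (ωX (z.1.1, z.2.1)) (ωY (z.1.2, z.2.2)) ^ q
        + β * |φX (z.1.1, z.2.1) - φY (z.1.2, z.2.2)| ^ q) ^ (p / q) := by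
    rw [Real.norm_of_nonneg (networkGap_nonneg hα hβ hαβ z), networkGap, weightedLqNorm,
      ← Real.rpow_mul (by positivity), one_div_mul_eq_div]
  rw [h.eLpNorm_eq_integral_rpow_norm (by simpa using hp0) ENNReal.ofReal_ne_top,
    ENNReal.toReal_ofReal (by positivity), integral_prod _ hint, ENNReal.toReal_ofReal hp0.le]
  simp only [hpow, FNGWcost, one_div]

lemma exists_FNGWcost_le_add [StandardBorelSpace X] [StandardBorelSpace Z]
    (hp : 1 ≤ p) (hq : 1 ≤ q) (hα : 0 ≤ α) (hβ : 0 ≤ β) (hαβ : α + β ≤ 1)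
    (hX : IsAttrNetwork p ψX φX ωX μX) (hY : IsAttrNetwork p ψY φY ωY μY)
    (hZ : IsAttrNetwork p ψZ φZ ωZ μZ)
    {π : Measure (X × Y)} {ρ : Measure (Y × Z)} (hπ : π ∈ Couplings μX μY)
    (hρ : ρ ∈ Couplings μY μZ) :
    ∃ τ ∈ Couplings μX μZ, FNGWcost p q α β ψX φX ωX ψZ φZ ωZ τ ≤
      FNGWcost p q α β ψX φX ωX ψY φY ωY π + FNGWcost p q α β ψY φY ωY ψZ φZ ωZ ρ := by
  have := hX.prob
  have := hZ.prob
  have : Nonempty X := nonempty_of_isProbabilityMeasure μX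
  have : Nonempty Z := nonempty_of_isProbabilityMeasure μZ
  obtain ⟨γ, _, hγπ, hγρ⟩ := exists_gluing hπ hρ
  have hτ : γ.map Prod.snd ∈ Couplings μX μZ := by
    refine ⟨Measure.isProbabilityMeasure_map measurable_snd.aemeasurable, ?_, ?_⟩
    · rw [← hπ.2.1, ← hγπ, Measure.map_map (by fun_prop) (by fun_prop),
        Measure.map_map (by fun_prop) (by fun_prop)]
      rfl
    · rw [← hρ.2.2, ← hγρ, Measure.map_map (by fun_prop) (by fun_prop),
        Measure.map_map (by fun_prop) (by fun_prop)]
      rfl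
  refine ⟨_, hτ, ?_⟩
  rw [FNGWcost_eq_toReal_eLpNorm hp hq hα hβ hαβ hX hZ hτ,
    FNGWcost_eq_toReal_eLpNorm hp hq hα hβ hαβ hX hY hπ,
    FNGWcost_eq_toReal_eLpNorm hp hq hα hβ hαβ hY hZ hρ]
  have LXY := memLp_networkGap hp hq hα hβ hαβ hX hY hπ
  have LYZ := memLp_networkGap hp hq hα hβ hαβ hY hZ hρ
  have LXZ := memLp_networkGap hp hq hα hβ hαβ hX hZ hτ
  have := hπ.1
  have := hρ.1
  have := hτ.1
  have mπ : MeasurePreserving (fun t : Y × X × Z ↦ (t.2.1, t.1)) γ π := ⟨by fun_prop, hγπ⟩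
  have mρ : MeasurePreserving (fun t : Y × X × Z ↦ (t.1, t.2.2)) γ ρ := ⟨by fun_prop, hγρ⟩
  have mτ : MeasurePreserving (Prod.snd : Y × X × Z → X × Z) γ (γ.map Prod.snd) :=
    ⟨measurable_snd, rfl⟩
  rw [← ENNReal.toReal_add LXY.2.ne LYZ.2.ne,
    ← eLpNorm_comp_measurePreserving LXY.1 (mπ.prod mπ),
    ← eLpNorm_comp_measurePreserving LYZ.1 (mρ.prod mρ),
    ← eLpNorm_comp_measurePreserving LXZ.1 (mτ.prod mτ)]
  have LXY' := LXY.comp_measurePreserving (mπ.prod mπ)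
  have LYZ' := LYZ.comp_measurePreserving (mρ.prod mρ)
  refine ENNReal.toReal_mono (ENNReal.add_ne_top.2 ⟨LXY'.2.ne, LYZ'.2.ne⟩) ?_
  refine le_trans (eLpNorm_mono_real fun t ↦ ?_)
    (eLpNorm_add_le LXY'.1 LYZ'.1 (ENNReal.one_le_ofReal.2 hp))
  rw [Function.comp_apply, Real.norm_of_nonneg (networkGap_nonneg hα hβ hαβ _)]
  exact networkGap_triangle hq hα hβ hαβ _ _ _ _ _ _

end Cost

/-- **The fused network Gromov–Wasserstein distance is symmetric, nonnegative, and
satisfies the triangle inequality** on attributed networks. -/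
theorem fngw_pseudometric
    {X₁ X₂ X₃ Ψ Ω : Type*}
    [MeasurableSpace X₁] [TopologicalSpace X₁] [PolishSpace X₁] [BorelSpace X₁]
    [MeasurableSpace X₂] [TopologicalSpace X₂] [PolishSpace X₂] [BorelSpace X₂]
    [MeasurableSpace X₃] [TopologicalSpace X₃] [PolishSpace X₃] [BorelSpace X₃]
    [MetricSpace Ψ] [MeasurableSpace Ψ] [BorelSpace Ψ] [TopologicalSpace.SeparableSpace Ψ]
    [MetricSpace Ω] [MeasurableSpace Ω] [BorelSpace Ω] [TopologicalSpace.SeparableSpace Ω]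
    (p q α β : ℝ) (hp : 1 ≤ p) (hq : 1 ≤ q)
    (hα : α ∈ Set.Icc (0 : ℝ) 1) (hβ : β ∈ Set.Icc (0 : ℝ) 1) (hαβ : α + β ≤ 1)
    (ψ₁ : X₁ → Ψ) (φ₁ : X₁ × X₁ → ℝ) (ω₁ : X₁ × X₁ → Ω) (μ₁ : Measure X₁)
    (h₁ : IsAttrNetwork p ψ₁ φ₁ ω₁ μ₁)
    (ψ₂ : X₂ → Ψ) (φ₂ : X₂ × X₂ → ℝ) (ω₂ : X₂ × X₂ → Ω) (μ₂ : Measure X₂)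
    (h₂ : IsAttrNetwork p ψ₂ φ₂ ω₂ μ₂)
    (ψ₃ : X₃ → Ψ) (φ₃ : X₃ × X₃ → ℝ) (ω₃ : X₃ × X₃ → Ω) (μ₃ : Measure X₃)
    (h₃ : IsAttrNetwork p ψ₃ φ₃ ω₃ μ₃) :
    FNGW p q α β ψ₁ φ₁ ω₁ μ₁ ψ₃ φ₃ ω₃ μ₃
        ≤ FNGW p q α β ψ₁ φ₁ ω₁ μ₁ ψ₂ φ₂ ω₂ μ₂
          + FNGW p q α β ψ₂ φ₂ ω₂ μ₂ ψ₃ φ₃ ω₃ μ₃ ∧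
    FNGW p q α β ψ₁ φ₁ ω₁ μ₁ ψ₂ φ₂ ω₂ μ₂ = FNGW p q α β ψ₂ φ₂ ω₂ μ₂ ψ₁ φ₁ ω₁ μ₁ ∧
    0 ≤ FNGW p q α β ψ₁ φ₁ ω₁ μ₁ ψ₂ φ₂ ω₂ μ₂ := by
  have hα0 := hα.1
  have hβ0 := hβ.1
  have := h₁.prob
  have := h₂.prob
  have := h₃.prob
  have : SecondCountableTopology Ψ := UniformSpace.secondCountable_of_separable Ψ
  have : SecondCountableTopology Ω := UniformSpace.secondCountable_of_separable Ω
  refine ⟨?_, ?_, ?_⟩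
  · simp only [FNGW, ← mul_add]
    refine mul_le_mul_of_nonneg_left ?_ (by norm_num)
    rw [← sub_le_iff_le_add]
    refine le_csInf (Set.Nonempty.image _ ⟨_, prod_mem_couplings⟩) ?_
    rintro _ ⟨π, hπ, rfl⟩
    rw [sub_le_comm]
    refine le_csInf (Set.Nonempty.image _ ⟨_, prod_mem_couplings⟩) ?_
    rintro _ ⟨ρ, hρ, rfl⟩
    rw [sub_le_iff_le_add']
    obtain ⟨τ, hτ, hle⟩ := exists_FNGWcost_le_add hp hq hα0 hβ0 hαβ h₁ h₂ h₃ hπ hρ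
    refine (csInf_le ⟨0, ?_⟩ (Set.mem_image_of_mem _ hτ)).trans hle
    rintro _ ⟨σ, -, rfl⟩
    exact FNGWcost_nonneg hα0 hβ0 hαβ σ
  · unfold FNGW
    congr 2
    ext c
    constructor
    · rintro ⟨π, hπ, rfl⟩
      exact ⟨_, map_swap_mem_couplings hπ, FNGWcost_map_swap π⟩
    · rintro ⟨π, hπ, rfl⟩
      exact ⟨_, map_swap_mem_couplings hπ, FNGWcost_map_swap π⟩
  · refine mul_nonneg (by norm_num) (Real.sInf_nonneg ?_)
    rintro _ ⟨π, -, rfl⟩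
    exact FNGWcost_nonneg hα0 hβ0 hαβ π
end
end

section
/- Quotient representation of GW over the unit interval: Let (Z, d_Z) be a separable metric space, p ∈ [1,∞), and let L denote Lebesgue measure on [0,1]. For any Borel maps ω, ω' : [0,1]² → Z with ∫∫ d_Z(ω(s,t), z₀)^p ds dt < ∞ and ∫∫ d_Z(ω'(s,t), z₀)^p ds dt < ∞ for some z₀ ∈ Z, one has GW_p^Z(([0,1], ω, L), ([0,1], ω', L)) = (1/2) inf { D_p(φ*ω, ψ*ω') : φ, ψ Borel maps [0,1] → [0,1] with φ_*L = L and ψ_*L = L }, where φ*ω(s,t) = ω(φ(s), φ(t)) and D_p(f,g) = (∫∫_{[0,1]²} d_Z(f(s,t), g(s,t))^p ds dt)^{1/p}. -/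
open MeasureTheory

noncomputable section

/-- Lebesgue measure on the unit interval `[0,1]`, as a measure on the subtype. -/
def unitMeasure : Measure (Set.Icc (0 : ℝ) 1) :=
  Measure.comap Subtype.val volume

instance : IsProbabilityMeasure unitMeasure :=
  inferInstanceAs (IsProbabilityMeasure (volume : Measure unitInterval))

/-- The integral underlying the distortion of a push-forward coupling. -/
theorem integral_integral_dist_map {Ω X Y Z : Type*} [MeasurableSpace Ω] [MeasurableSpace X]
    [MeasurableSpace Y] [MetricSpace Z] [MeasurableSpace Z] [BorelSpace Z]
    [TopologicalSpace.SeparableSpace Z] (p : ℝ) {ωX : X × X → Z} {ωY : Y × Y → Z}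
    (hX : Measurable ωX) (hY : Measurable ωY) (μ : Measure Ω) [SFinite μ]
    {T : Ω → X × Y} (hT : Measurable T) :
    ∫ w, ∫ w', dist (ωX (w.1, w'.1)) (ωY (w.2, w'.2)) ^ p ∂μ.map T ∂μ.map T =
      ∫ s, ∫ t, dist (ωX ((T s).1, (T t).1)) (ωY ((T s).2, (T t).2)) ^ p ∂μ ∂μ := by
  have : SecondCountableTopology Z := UniformSpace.secondCountable_of_separable Z
  have hmeas : Measurable fun q : (X × Y) × (X × Y) ↦
      dist (ωX (q.1.1, q.2.1)) (ωY (q.1.2, q.2.2)) ^ p := by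
    fun_prop
  rw [integral_map hT.aemeasurable
    hmeas.stronglyMeasurable.integral_prod_right'.aestronglyMeasurable]
  congr with s
  exact integral_map hT.aemeasurable
    (hmeas.comp measurable_prodMk_left).aestronglyMeasurable

/-- Every coupling of `unitMeasure` with itself, and nothing else, is the law of a pair of
measure-preserving maps of the unit interval. -/
theorem mem_couplings_unitMeasure_iff {π : Measure (Set.Icc (0 : ℝ) 1 × Set.Icc (0 : ℝ) 1)} :
    π ∈ Couplings unitMeasure unitMeasure ↔
      ∃ φ ψ : Set.Icc (0 : ℝ) 1 → Set.Icc (0 : ℝ) 1,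
        MeasurePreserving φ unitMeasure unitMeasure ∧
        MeasurePreserving ψ unitMeasure unitMeasure ∧
        unitMeasure.map (fun s ↦ (φ s, ψ s)) = π := by
  constructor
  · rintro ⟨hπ, h₁, h₂⟩
    obtain ⟨T, hT, hTπ⟩ := π.exists_measurable_map_eq
    change unitMeasure.map T = π at hTπ
    refine ⟨fun s ↦ (T s).1, fun s ↦ (T s).2, ⟨hT.fst, ?_⟩, ⟨hT.snd, ?_⟩, hTπ⟩
    · rw [← hTπ, Measure.map_map measurable_fst hT] at h₁
      exact h₁
    · rw [← hTπ, Measure.map_map measurable_snd hT] at h₂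
      exact h₂
  · rintro ⟨φ, ψ, hφ, hψ, rfl⟩
    have hT := hφ.measurable.prodMk hψ.measurable
    refine ⟨Measure.isProbabilityMeasure_map hT.aemeasurable, ?_, ?_⟩
    · rw [Measure.map_map measurable_fst hT]
      exact hφ.map_eq
    · rw [Measure.map_map measurable_snd hT]
      exact hψ.map_eq

/-- **Quotient representation of `GW` over the unit interval**: for kernels `ω, ω'` on
`[0,1]²` (with Lebesgue measure `L`), the `Z`-Gromov–Wasserstein distance equals half
the infimum of the `L^p` distances `D_p(φ*ω, ψ*ω')` over all Borel measure-preserving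
maps `φ, ψ : [0,1] → [0,1]`. -/
theorem gw_eq_inf_pullback_Lp
    {Z : Type*} [MetricSpace Z] [MeasurableSpace Z] [BorelSpace Z]
    [TopologicalSpace.SeparableSpace Z]
    (p : ℝ) (hp : 1 ≤ p)
    (ω ω' : (Set.Icc (0 : ℝ) 1 × Set.Icc (0 : ℝ) 1) → Z)
    (hω : Measurable ω) (hω' : Measurable ω')
    (hint : ∃ z₀ : Z,
      (∫⁻ s, ∫⁻ t, ENNReal.ofReal (dist (ω (s, t)) z₀ ^ p) ∂unitMeasure ∂unitMeasure) < ⊤)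
    (hint' : ∃ z₀ : Z,
      (∫⁻ s, ∫⁻ t, ENNReal.ofReal (dist (ω' (s, t)) z₀ ^ p) ∂unitMeasure ∂unitMeasure) < ⊤) :
    GW p ω unitMeasure ω' unitMeasure =
      (1 / 2) * sInf { r : ℝ |
        ∃ φ ψ : Set.Icc (0 : ℝ) 1 → Set.Icc (0 : ℝ) 1,
          MeasurePreserving φ unitMeasure unitMeasure ∧
          MeasurePreserving ψ unitMeasure unitMeasure ∧
          r = (∫ s, ∫ t, dist (ω (φ s, φ t)) (ω' (ψ s, ψ t)) ^ p
                ∂unitMeasure ∂unitMeasure) ^ (1 / p) } := by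
  rw [GW]
  congr 2
  ext r
  simp only [Set.mem_image, mem_couplings_unitMeasure_iff]
  constructor
  · rintro ⟨_, ⟨φ, ψ, hφ, hψ, rfl⟩, rfl⟩
    refine ⟨φ, ψ, hφ, hψ, ?_⟩
    rw [dis, integral_integral_dist_map p hω hω' _ (hφ.measurable.prodMk hψ.measurable)]
  · rintro ⟨φ, ψ, hφ, hψ, rfl⟩
    refine ⟨_, ⟨φ, ψ, hφ, hψ, rfl⟩, ?_⟩
    rw [dis, integral_integral_dist_map p hω hω' _ (hφ.measurable.prodMk hψ.measurable)]
end
end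

section
/- Density of finite networks: Let (Z, d_Z) be a separable metric space and p ∈ [1,∞). For every (Z,p)-network X and every ε > 0, there exist n ∈ ℕ, n ≥ 1, and a function Ω_n : {1,…,n} × {1,…,n} → Z such that GW_p^Z(X, X_n) < ε, where X_n is the (Z,p)-network ({1,…,n}, Ω_n, (1/n)∑_{i=1}^n δ_i) with the uniform probability measure on {1,…,n}. -/
open MeasureTheory

noncomputable section

/-- The uniform probability measure `(1/n) ∑ᵢ δᵢ` on `{1, …, n}` (modeled as `Fin n`). -/
def uniformFin (n : ℕ) : Measure (Fin n) :=
  (n : ENNReal)⁻¹ • ∑ i : Fin n, Measure.dirac i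

open scoped unitInterval ENNReal

/-- A finite measurable partition into cells of positive measure admits representatives at which
a given function is, on average, no larger than its integral. -/
lemma exists_representatives_lintegral_le {S ι : Type*} [MeasurableSpace S] [Finite ι]
    [MeasurableSpace ι] [MeasurableSingletonClass ι] {μ : Measure S} [IsFiniteMeasure μ]
    {q : S → ι} (hq : Measurable q) (hpos : ∀ c, μ (q ⁻¹' {c}) ≠ 0)
    {h : S → ℝ≥0∞} (hh : AEMeasurable h μ) :
    ∃ y : ι → S, (∀ c, q (y c) = c) ∧ ∫⁻ x, h (y (q x)) ∂μ ≤ ∫⁻ x, h x ∂μ := by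
  have hcell (c : ι) : MeasurableSet (q ⁻¹' {c}) := hq (measurableSet_singleton c)
  have key (c : ι) : ∃ x ∈ q ⁻¹' {c}, h x ≤ ⨍⁻ a in q ⁻¹' {c}, h a ∂μ :=
    exists_le_setLAverage (hpos c) (measure_ne_top _ _) hh.restrict
  choose y hy hyle using key
  refine ⟨y, hy, ?_⟩
  have hunion : (⋃ c, q ⁻¹' {c}) = Set.univ := by ext; simp
  have hdisj : Pairwise (Function.onFun Disjoint fun c ↦ q ⁻¹' {c}) := fun a b hab ↦
    Disjoint.preimage q (Set.disjoint_singleton.2 hab)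
  rw [← setLIntegral_univ, ← setLIntegral_univ (μ := μ) h, ← hunion,
    lintegral_iUnion hcell hdisj, lintegral_iUnion hcell hdisj]
  refine ENNReal.tsum_le_tsum fun c ↦ ?_
  calc ∫⁻ x in q ⁻¹' {c}, h (y (q x)) ∂μ = ∫⁻ _ in q ⁻¹' {c}, h (y c) ∂μ :=
        setLIntegral_congr_fun (hcell c) fun x hx ↦ by
          simp only [Set.mem_preimage, Set.mem_singleton_iff] at hx
          simp only [hx]
    _ = h (y c) * μ (q ⁻¹' {c}) := setLIntegral_const _ _
    _ ≤ (⨍⁻ a in q ⁻¹' {c}, h a ∂μ) * μ (q ⁻¹' {c}) := by gcongr; exact hyle c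
    _ = ∫⁻ x in q ⁻¹' {c}, h x ∂μ := by
        rw [mul_comm, measure_mul_setLAverage _ (measure_ne_top _ _)]

/-- The index of the cell containing a point, when the unit interval is cut into `n` intervals of
equal length. -/
def gridIndex (n : ℕ) [NeZero n] (t : I) : Fin n :=
  ⟨min ⌊n * (t : ℝ)⌋₊ (n - 1), by have := NeZero.pos n; omega⟩

lemma measurable_gridIndex (n : ℕ) [NeZero n] : Measurable (gridIndex n) := by
  have h : Measurable fun t : I ↦ min ⌊n * (t : ℝ)⌋₊ (n - 1) :=
    (Nat.measurable_floor.comp (by fun_prop)).min measurable_const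
  refine measurable_to_countable' fun c ↦ ?_
  convert h (measurableSet_singleton (c : ℕ)) using 1
  ext t
  simp [gridIndex, Fin.ext_iff]

lemma div_mem_unitInterval {n k : ℕ} (h : k ≤ n) : (k / n : ℝ) ∈ I :=
  ⟨by positivity, div_le_one_of_le₀ (by exact_mod_cast h) (by positivity)⟩

lemma Ico_subset_preimage_gridIndex (n : ℕ) [NeZero n] (i : Fin n) :
    Set.Ico (⟨(i : ℕ) / n, div_mem_unitInterval i.2.le⟩ : I)
      ⟨((i + 1 : ℕ) : ℝ) / n, div_mem_unitInterval i.2⟩ ⊆ gridIndex n ⁻¹' {i} := by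
  have hn : (0 : ℝ) < n := by exact_mod_cast NeZero.pos n
  rintro t ⟨h1, h2⟩
  rw [← Subtype.coe_le_coe, div_le_iff₀ hn] at h1
  rw [← Subtype.coe_lt_coe, lt_div_iff₀ hn] at h2
  have : ⌊n * (t : ℝ)⌋₊ = i := by
    rw [Nat.floor_eq_iff (mul_nonneg hn.le t.2.1)]
    push_cast at h2
    constructor <;> linarith
  have hi := i.2
  simp only [Set.mem_preimage, Set.mem_singleton_iff, Fin.ext_iff, gridIndex, this]
  omega

lemma preimage_gridIndex_subset_Icc (n : ℕ) [NeZero n] (i : Fin n) :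
    gridIndex n ⁻¹' {i} ⊆ Set.Icc (⟨(i : ℕ) / n, div_mem_unitInterval i.2.le⟩ : I)
      ⟨((i + 1 : ℕ) : ℝ) / n, div_mem_unitInterval i.2⟩ := by
  have hn : (0 : ℝ) < n := by exact_mod_cast NeZero.pos n
  intro t ht
  simp only [Set.mem_preimage, Set.mem_singleton_iff, Fin.ext_iff, gridIndex] at ht
  have ht0 : 0 ≤ n * (t : ℝ) := mul_nonneg hn.le t.2.1
  have h1 := Nat.floor_le ht0
  have h2 := Nat.lt_floor_add_one (n * (t : ℝ))
  have h3 : (i : ℕ) ≤ ⌊n * (t : ℝ)⌋₊ := by omega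
  have h3' : ((i : ℕ) : ℝ) ≤ ⌊n * (t : ℝ)⌋₊ := by exact_mod_cast h3
  constructor
  · rw [← Subtype.coe_le_coe, div_le_iff₀ hn]
    linarith
  · rw [← Subtype.coe_le_coe, le_div_iff₀ hn]
    push_cast
    rcases le_total ⌊n * (t : ℝ)⌋₊ (n - 1) with h | h
    · rw [min_eq_left h] at ht
      rw [ht] at h2
      linarith
    · rw [min_eq_right h] at ht
      have h4 : (i : ℕ) + 1 = n := by have := NeZero.pos n; omega
      have h4' : ((i : ℕ) : ℝ) + 1 = n := by exact_mod_cast h4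
      rw [h4']
      nlinarith [t.2.2]

lemma volume_preimage_gridIndex (n : ℕ) [NeZero n] (i : Fin n) :
    volume (gridIndex n ⁻¹' {i}) = (n : ℝ≥0∞)⁻¹ := by
  have hn : (0 : ℝ) < n := by exact_mod_cast NeZero.pos n
  have hlen : ENNReal.ofReal (((i + 1 : ℕ) : ℝ) / n - (i : ℕ) / n) = (n : ℝ≥0∞)⁻¹ := by
    rw [← sub_div]
    push_cast
    rw [add_sub_cancel_left, one_div, ENNReal.ofReal_inv_of_pos hn, ENNReal.ofReal_natCast]
  apply le_antisymm
  · refine (measure_mono (preimage_gridIndex_subset_Icc n i)).trans_eq ?_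
    rw [unitInterval.volume_Icc, hlen]
  · refine Eq.trans_le ?_ (measure_mono (Ico_subset_preimage_gridIndex n i))
    rw [unitInterval.volume_Ico, hlen]

lemma map_gridIndex_volume (n : ℕ) [NeZero n] :
    (volume : Measure I).map (gridIndex n) = uniformFin n := by
  refine Measure.ext_of_singleton fun i ↦ ?_
  rw [Measure.map_apply (measurable_gridIndex n) (measurableSet_singleton i),
    volume_preimage_gridIndex]
  simp [uniformFin, Measure.finsetSum_apply, Set.indicator_apply]

lemma dist_le_of_gridIndex_eq {n : ℕ} [NeZero n] {s t : I} (h : gridIndex n s = gridIndex n t) :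
    dist s t ≤ 1 / n := by
  have hs := preimage_gridIndex_subset_Icc n (gridIndex n t) (show s ∈ _ from h)
  have ht := preimage_gridIndex_subset_Icc n (gridIndex n t) (show t ∈ _ from rfl)
  have hd := Real.dist_le_of_mem_Icc (x := (s : ℝ)) (y := (t : ℝ)) hs ht
  rw [← sub_div] at hd
  push_cast at hd
  rwa [add_sub_cancel_left] at hd

/-- An `L^p` function on the unit square is approximated in `L^p` by functions constant on the
cells of a grid, whose values are values of the function. -/
lemma exists_grid_eLpNorm_sub_le {E : Type*} [NormedAddCommGroup E] [NormedSpace ℝ E]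
    {r : ℝ≥0∞} (hr : 1 ≤ r) (hr' : r ≠ ∞) {F : I × I → E} (hF : MemLp F r volume)
    {δ : ℝ} (hδ : 0 < δ) :
    ∃ (n : ℕ) (_ : NeZero n) (y : Fin n × Fin n → I × I),
      eLpNorm (fun x ↦ F x - F (y (gridIndex n x.1, gridIndex n x.2))) r volume
        ≤ ENNReal.ofReal (3 * δ) := by
  obtain ⟨g, hgc, hg⟩ : ∃ g : I × I → E, Continuous g ∧
      eLpNorm (F - g) r volume ≤ ENNReal.ofReal δ := by
    obtain ⟨g, hg, -⟩ := hF.exists_boundedContinuous_eLpNorm_sub_le hr'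
      (ENNReal.ofReal_pos.2 hδ).ne'
    exact ⟨g, g.continuous, hg⟩
  have hgu : UniformContinuous g := CompactSpace.uniformContinuous_of_continuous hgc
  obtain ⟨η, hη, hgη⟩ := Metric.uniformContinuous_iff.1 hgu δ hδ
  obtain ⟨m, hm⟩ := exists_nat_one_div_lt hη
  let n := m + 1
  let q : I × I → Fin n × Fin n := fun x ↦ (gridIndex n x.1, gridIndex n x.2)
  have hq : Measurable q :=
    ((measurable_gridIndex n).comp measurable_fst).prodMk
      ((measurable_gridIndex n).comp measurable_snd)
  have hpos (c : Fin n × Fin n) : (volume : Measure (I × I)) (q ⁻¹' {c}) ≠ 0 := by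
    have : q ⁻¹' {c} = (gridIndex n ⁻¹' {c.1}) ×ˢ (gridIndex n ⁻¹' {c.2}) := by
      ext x; simp [q, Prod.ext_iff]
    rw [this, Measure.volume_eq_prod, Measure.prod_prod, volume_preimage_gridIndex,
      volume_preimage_gridIndex]
    simp
  have hFg : AEStronglyMeasurable (F - g) volume :=
    hF.1.sub hgc.aestronglyMeasurable
  obtain ⟨y, hy, hyle⟩ := exists_representatives_lintegral_le (μ := volume) hq hpos
    (h := fun x ↦ ‖(F - g) x‖ₑ ^ r.toReal) (hFg.enorm.pow_const _)
  refine ⟨n, inferInstance, y, ?_⟩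
  have hr0 : r ≠ 0 := (zero_lt_one.trans_le hr).ne'
  have hmeas (f : I × I → E) : StronglyMeasurable fun x ↦ f (y (q x)) :=
    (StronglyMeasurable.of_discrete (f := fun c ↦ f (y c))).comp_measurable hq
  have h3 : eLpNorm (fun x ↦ (F - g) (y (q x))) r volume ≤ ENNReal.ofReal δ := by
    refine le_trans ?_ hg
    rw [eLpNorm_eq_lintegral_rpow_enorm_toReal hr0 hr',
      eLpNorm_eq_lintegral_rpow_enorm_toReal hr0 hr']
    gcongr
  have h2 : eLpNorm (fun x ↦ g x - g (y (q x))) r volume ≤ ENNReal.ofReal δ := by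
    refine (eLpNorm_le_of_ae_bound (C := δ) (ae_of_all _ fun x ↦ ?_)).trans ?_
    · rw [← dist_eq_norm]
      refine (hgη ?_).le
      have hx := Prod.ext_iff.1 (hy (q x))
      rw [dist_comm, Prod.dist_eq]
      refine lt_of_le_of_lt ?_ hm
      have e : (1 : ℝ) / (m + 1) = 1 / (n : ℕ) := by simp [n]
      rw [e]
      exact max_le (dist_le_of_gridIndex_eq hx.1) (dist_le_of_gridIndex_eq hx.2)
    · simp
  have hdecomp : (fun x ↦ F x - F (y (q x))) =
      ((F - g) + fun x ↦ g x - g (y (q x))) - fun x ↦ (F - g) (y (q x)) := by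
    ext1 x
    simp only [Pi.sub_apply, Pi.add_apply]
    abel
  have hgm : AEStronglyMeasurable (fun x ↦ g x - g (y (q x))) volume :=
    hgc.aestronglyMeasurable.sub (hmeas g).aestronglyMeasurable
  change eLpNorm (fun x ↦ F x - F (y (q x))) r volume ≤ _
  rw [hdecomp]
  calc _ ≤ eLpNorm ((F - g) + fun x ↦ g x - g (y (q x))) r volume
        + eLpNorm (fun x ↦ (F - g) (y (q x))) r volume :=
        eLpNorm_sub_le (hFg.add hgm) (hmeas _).aestronglyMeasurable hr
    _ ≤ (eLpNorm (F - g) r volume + eLpNorm (fun x ↦ g x - g (y (q x))) r volume)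
        + eLpNorm (fun x ↦ (F - g) (y (q x))) r volume := by
        gcongr
        exact eLpNorm_add_le hFg hgm hr
    _ ≤ (ENNReal.ofReal δ + ENNReal.ofReal δ) + ENNReal.ofReal δ := by gcongr
    _ = ENNReal.ofReal (3 * δ) := by
        rw [← ENNReal.ofReal_add hδ.le hδ.le, ← ENNReal.ofReal_add (by positivity) hδ.le]
        ring_nf

/-- The distortion of a coupling parametrized by a probability space is an `L^p` norm. -/
lemma dis_map_eq_toReal_eLpNorm {T X Y Z E : Type*} [MeasurableSpace T] [MeasurableSpace X]
    [MeasurableSpace Y] [PseudoMetricSpace Z] [NormedAddCommGroup E]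
    {p : ℝ} (hp : 0 < p) {ωX : X × X → Z} {ωY : Y × Y → Z} {ν : Measure T}
    [IsProbabilityMeasure ν] {ψ : T → X × Y} (hψ : Measurable ψ) {D : T × T → E}
    (hdist : Measurable fun v : (X × Y) × (X × Y) ↦
      dist (ωX (v.1.1, v.2.1)) (ωY (v.1.2, v.2.2)))
    (hnorm : ∀ s t, ‖D (s, t)‖ = dist (ωX ((ψ s).1, (ψ t).1)) (ωY ((ψ s).2, (ψ t).2)))
    (hD : MemLp D (ENNReal.ofReal p) (ν.prod ν)) :
    dis p ωX ωY (ν.map ψ) = (eLpNorm D (ENNReal.ofReal p) (ν.prod ν)).toReal := by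
  have hp0 : ENNReal.ofReal p ≠ 0 := (ENNReal.ofReal_pos.2 hp).ne'
  have hint := hD.integrable_norm_rpow hp0 ENNReal.ofReal_ne_top
  rw [ENNReal.toReal_ofReal hp.le] at hint
  have := Measure.isProbabilityMeasure_map (μ := ν) hψ.aemeasurable
  have hG : StronglyMeasurable fun v : (X × Y) × (X × Y) ↦
      dist (ωX (v.1.1, v.2.1)) (ωY (v.1.2, v.2.2)) ^ p := (hdist.pow_const p).stronglyMeasurable
  rw [hD.eLpNorm_eq_integral_rpow_norm hp0 ENNReal.ofReal_ne_top, ENNReal.toReal_ofReal hp.le,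
    ENNReal.toReal_ofReal (by positivity), dis, one_div, integral_prod _ hint]
  congr 1
  rw [integral_map hψ.aemeasurable hG.integral_prod_right'.aestronglyMeasurable]
  congr 1 with s
  refine (integral_map hψ.aemeasurable
    (hG.comp_measurable measurable_prodMk_left).aestronglyMeasurable).trans ?_
  simp only [hnorm, Function.comp_apply]

lemma GW_le_half_dis {X Y Z : Type*} [MeasurableSpace X] [MeasurableSpace Y]
    [PseudoMetricSpace Z] {p : ℝ} {ωX : X × X → Z} {μX : Measure X} {ωY : Y × Y → Z}
    {μY : Measure Y} {π : Measure (X × Y)} (hπ : π ∈ Couplings μX μY) :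
    GW p ωX μX ωY μY ≤ 1 / 2 * dis p ωX ωY π := by
  refine mul_le_mul_of_nonneg_left (csInf_le ⟨0, ?_⟩ ⟨π, hπ, rfl⟩) (by norm_num)
  rintro _ ⟨π', -, rfl⟩
  exact Real.rpow_nonneg (integral_nonneg fun _ ↦ integral_nonneg fun _ ↦ by positivity) _

/-- **Density of finite networks**: every `(Z,p)`-network can be approximated arbitrarily
well in `GW_p^Z` by an `n`-point `Z`-network carrying the uniform measure. -/
theorem finite_networks_dense
    {X Z : Type*}
    [MeasurableSpace X] [TopologicalSpace X] [PolishSpace X] [BorelSpace X]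
    [MetricSpace Z] [MeasurableSpace Z] [BorelSpace Z] [TopologicalSpace.SeparableSpace Z]
    (p : ℝ) (hp : 1 ≤ p)
    (ωX : X × X → Z) (μX : Measure X) (hX : IsNetwork p ωX μX)
    (ε : ℝ) (hε : 0 < ε) :
    ∃ (n : ℕ), 1 ≤ n ∧ ∃ Ωn : Fin n × Fin n → Z,
      GW p ωX μX Ωn (uniformFin n) < ε := by
  have hp0 : 0 < p := zero_lt_one.trans_le hp
  have hpr : ENNReal.ofReal p ≠ 0 := (ENNReal.ofReal_pos.2 hp0).ne'
  have := hX.prob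
  obtain ⟨z₀, hz₀⟩ := hX.integ
  have : SecondCountableTopology Z := UniformSpace.secondCountable_of_separable Z
  have : Nonempty X := nonempty_of_isProbabilityMeasure μX
  obtain ⟨φ, hφ, hφμ⟩ := μX.exists_measurable_map_eq
  let K := kuratowskiEmbedding Z
  have hK : Isometry K := kuratowskiEmbedding.isometry Z
  let f : I × I → Z := fun x ↦ ωX (φ x.1, φ x.2)
  have hf : Measurable f := hX.meas.comp (by fun_prop)
  let F : I × I → _ := fun x ↦ K (f x) - K z₀
  have hFm : StronglyMeasurable F :=
    (hK.continuous.comp_stronglyMeasurable hf.stronglyMeasurable).sub stronglyMeasurable_const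
  have hFn (x : I × I) : ‖F x‖ = dist (f x) z₀ := by
    rw [← dist_eq_norm, hK.dist_eq]
  have hωm : Measurable fun v : X × X ↦ ENNReal.ofReal (dist (ωX v) z₀ ^ p) :=
    ((hX.meas.dist measurable_const).pow_const p).ennreal_ofReal
  have hF : MemLp F (ENNReal.ofReal p) volume := by
    refine ⟨hFm.aestronglyMeasurable, ?_⟩
    rw [eLpNorm_lt_top_iff_lintegral_rpow_enorm_lt_top hpr ENNReal.ofReal_ne_top,
      ENNReal.toReal_ofReal hp0.le]
    have hpt (x : I × I) : ‖F x‖ₑ ^ p = ENNReal.ofReal (dist (f x) z₀ ^ p) := by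
      rw [← ofReal_norm, hFn, ENNReal.ofReal_rpow_of_nonneg dist_nonneg hp0.le]
    simp only [hpt]
    rw [Measure.volume_eq_prod, lintegral_prod _ (by fun_prop)]
    convert hz₀ using 1
    rw [← hφμ, lintegral_map hωm.lintegral_prod_right' hφ]
    congr 1 with s
    exact (lintegral_map (f := fun y ↦ ENNReal.ofReal (dist (ωX (φ s, y)) z₀ ^ p))
      (hωm.comp measurable_prodMk_left) hφ).symm
  obtain ⟨n, hn, y, hy⟩ := exists_grid_eLpNorm_sub_le (ENNReal.one_le_ofReal.2 hp)
    ENNReal.ofReal_ne_top hF (δ := ε / 3) (by positivity)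
  let ψ : I → X × Fin n := fun t ↦ (φ t, gridIndex n t)
  have hψ : Measurable ψ := hφ.prodMk (measurable_gridIndex n)
  let Ω : Fin n × Fin n → Z := fun c ↦ f (y c)
  refine ⟨n, NeZero.one_le, Ω, ?_⟩
  have hπ : (volume : Measure I).map ψ ∈ Couplings μX (uniformFin n) := by
    refine ⟨Measure.isProbabilityMeasure_map hψ.aemeasurable, ?_, ?_⟩
    · rw [Measure.map_map measurable_fst hψ]
      exact hφμ
    · rw [Measure.map_map measurable_snd hψ]
      exact map_gridIndex_volume n
  have hgrid : Measurable fun x : I × I ↦ (gridIndex n x.1, gridIndex n x.2) :=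
    ((measurable_gridIndex n).comp measurable_fst).prodMk
      ((measurable_gridIndex n).comp measurable_snd)
  have hD : MemLp (fun x : I × I ↦ F x - F (y (gridIndex n x.1, gridIndex n x.2)))
      (ENNReal.ofReal p) volume :=
    ⟨(hFm.sub ((StronglyMeasurable.of_discrete (f := fun c ↦ F (y c))).comp_measurable
      hgrid)).aestronglyMeasurable, hy.trans_lt ENNReal.ofReal_lt_top⟩
  have hΩ : Measurable Ω := measurable_of_finite Ω
  have hdis := dis_map_eq_toReal_eLpNorm (ωX := ωX) (ωY := Ω) hp0 hψ
    ((hX.meas.comp (by fun_prop)).dist (hΩ.comp (by fun_prop)))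
    (fun s t ↦ by
      rw [← hK.dist_eq, dist_eq_norm, sub_sub_sub_cancel_right]) hD
  have hle : dis p ωX Ω ((volume : Measure I).map ψ) ≤ ε := by
    rw [hdis]
    refine ENNReal.toReal_le_of_le_ofReal hε.le (hy.trans_eq ?_)
    ring_nf
  linarith [GW_le_half_dis (p := p) (ωX := ωX) (ωY := Ω) hπ]
end
end

section
/- Approximation of Z-GW by ℝⁿ-GW: Let (Z, d_Z) be a bounded separable metric space, p ∈ [1,∞), n ≥ 1, r ∈ [1,∞], and fix Q = (q₁,…,q_n) ∈ Zⁿ. For (Z,p)-networks X = (X, ω_X, μ_X) and Y = (Y, ω_Y, μ_Y), define ℝⁿ-networks X_Q = (X, ω_{X_Q}, μ_X) and Y_Q = (Y, ω_{Y_Q}, μ_Y), where ω_{X_Q}(x,x') = (d_Z(ω_X(x,x'), q_i))_{i=1}^n and similarly for Y, and equip ℝⁿ with the ℓ^r metric. Then n^{−1/r} · GW_p^{ℝⁿ}(X_Q, Y_Q) ≤ GW_p^Z(X, Y) ≤ GW_p^{ℝⁿ}(X_Q, Y_Q) + H(Z, Q), where H(Z, Q) is the Hausdorff distance in Z between Z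 and the finite set {q₁,…,q_n}, and n^{−1/∞} is interpreted as 1. -/
open MeasureTheory

noncomputable section

section LandmarkEmbedding

variable {Z : Type*} [PseudoMetricSpace Z] {n : ℕ} (r : ENNReal) [Fact (1 ≤ r)] (Q : Fin n → Z)

/-- The map `z ↦ (d(z, q_i))_i` into `ℝⁿ` with the `ℓ^r` metric. -/
def landmarkEmbedding (z : Z) : WithLp r (Fin n → ℝ) :=
  (WithLp.equiv r (Fin n → ℝ)).symm fun i => dist z (Q i)

theorem lipschitzWith_landmarkEmbedding :
    LipschitzWith ((n : NNReal) ^ (1 / r).toReal) (landmarkEmbedding r Q) := by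
  have hpi : LipschitzWith 1 fun z i => dist z (Q i) := LipschitzWith.of_dist_le_mul fun a b => by
    simpa using (dist_pi_le_iff dist_nonneg).2 fun i => by
      simpa [Real.dist_eq] using abs_dist_sub_le a b (Q i)
  have h := (PiLp.lipschitzWith_toLp r fun _ : Fin n => ℝ).comp hpi
  rw [Fintype.card_fin, mul_one] at h
  exact h

theorem abs_dist_sub_dist_le_dist_landmarkEmbedding (a b : Z) (i : Fin n) :
    |dist a (Q i) - dist b (Q i)| ≤ dist (landmarkEmbedding r Q a) (landmarkEmbedding r Q b) := by
  have h := (PiLp.lipschitzWith_ofLp r fun _ : Fin n => ℝ).dist_le_mul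
    (landmarkEmbedding r Q a) (landmarkEmbedding r Q b)
  simpa [landmarkEmbedding, Real.dist_eq] using (dist_le_pi_dist _ _ i).trans h

theorem dist_le_dist_landmarkEmbedding_add [Nonempty (Fin n)] {C : ℝ}
    (hC : ∀ z w : Z, dist z w ≤ C) (a b : Z) :
    dist a b ≤ dist (landmarkEmbedding r Q a) (landmarkEmbedding r Q b)
      + 2 * ⨆ z : Z, ⨅ i : Fin n, dist z (Q i) := by
  obtain ⟨i, hi⟩ := exists_eq_ciInf_of_finite (f := fun i => dist a (Q i))
  have hbdd : BddAbove (Set.range fun z => ⨅ i : Fin n, dist z (Q i)) := by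
    refine ⟨C, ?_⟩
    rintro _ ⟨z, rfl⟩
    exact (ciInf_le (Set.finite_range _).bddBelow (Classical.arbitrary _)).trans (hC _ _)
  have hsup := le_ciSup hbdd a
  have hcoord := abs_le.1 (abs_dist_sub_dist_le_dist_landmarkEmbedding r Q a b i)
  have htri := dist_triangle_right a b (Q i)
  linarith [hcoord.1]

end LandmarkEmbedding

theorem Couplings.nonempty {X Y : Type*} [MeasurableSpace X] [MeasurableSpace Y]
    (μ : Measure X) (ν : Measure Y) [IsProbabilityMeasure μ] [IsProbabilityMeasure ν] :
    (Couplings μ ν).Nonempty :=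
  ⟨μ.prod ν, inferInstance, by simp, by simp⟩

theorem dis_nonneg {X Y Z : Type*} [MeasurableSpace X] [MeasurableSpace Y] [PseudoMetricSpace Z]
    (p : ℝ) (ωX : X × X → Z) (ωY : Y × Y → Z) (π : Measure (X × Y)) : 0 ≤ dis p ωX ωY π := by
  unfold dis
  positivity

theorem bddBelow_dis_image {X Y Z : Type*} [MeasurableSpace X] [MeasurableSpace Y]
    [PseudoMetricSpace Z] (p : ℝ) (ωX : X × X → Z) (ωY : Y × Y → Z)
    (S : Set (Measure (X × Y))) : BddBelow (dis p ωX ωY '' S) :=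
  ⟨0, by rintro _ ⟨π, -, rfl⟩; exact dis_nonneg p ωX ωY π⟩

section Distortion

variable {X Y Z : Type*} [MeasurableSpace X] [MeasurableSpace Y] [PseudoMetricSpace Z]

/-- The integrand of the distortion, as a function on the square of `X × Y`. -/
def distortionFun (ωX : X × X → Z) (ωY : Y × Y → Z) (v : (X × Y) × (X × Y)) : ℝ :=
  dist (ωX (v.1.1, v.2.1)) (ωY (v.1.2, v.2.2))

theorem dis_eq_lpNorm {p : ℝ} (hp : 1 ≤ p) {ωX : X × X → Z} {ωY : Y × Y → Z}
    {π : Measure (X × Y)} [SFinite π]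
    (h : MemLp (distortionFun ωX ωY) (ENNReal.ofReal p) (π.prod π)) :
    dis p ωX ωY π = lpNorm (distortionFun ωX ωY) (ENNReal.ofReal p) (π.prod π) := by
  have hp0 : ENNReal.ofReal p ≠ 0 := by simp; linarith
  have hint := h.integrable_norm_rpow hp0 ENNReal.ofReal_ne_top
  rw [lpNorm_eq_integral_norm_rpow_toReal hp0 ENNReal.ofReal_ne_top h.1, integral_prod _ hint]
  simp [dis, distortionFun, ENNReal.toReal_ofReal (zero_le_one.trans hp), abs_of_nonneg]

variable [MeasurableSpace Z] [BorelSpace Z] [SecondCountableTopology Z]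
  {W : Type*} [PseudoMetricSpace W] {C : ℝ} {K : NNReal} {f : Z → W}
  {ωX : X × X → Z} {ωY : Y × Y → Z}

theorem memLp_distortionFun_comp (hC : ∀ z w : Z, dist z w ≤ C) (hf : LipschitzWith K f)
    (hX : Measurable ωX) (hY : Measurable ωY) (q : ENNReal) (ν : Measure ((X × Y) × (X × Y)))
    [IsFiniteMeasure ν] : MemLp (distortionFun (f ∘ ωX) (f ∘ ωY)) q ν := by
  have hcont : Continuous fun z : Z × Z => dist (f z.1) (f z.2) :=
    (hf.continuous.comp continuous_fst).dist (hf.continuous.comp continuous_snd)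
  have hmeas : Measurable (distortionFun (f ∘ ωX) (f ∘ ωY)) :=
    hcont.measurable.comp (g := fun z : Z × Z => dist (f z.1) (f z.2))
      (f := fun v : (X × Y) × (X × Y) => (ωX (v.1.1, v.2.1), ωY (v.1.2, v.2.2))) (by fun_prop)
  refine MemLp.of_bound hmeas.aestronglyMeasurable (K * C) (ae_of_all _ fun v => ?_)
  rw [distortionFun, Real.norm_of_nonneg dist_nonneg]
  exact (hf.dist_le_mul _ _).trans (mul_le_mul_of_nonneg_left (hC _ _) K.2)

theorem dis_comp_le_mul {p : ℝ} (hp : 1 ≤ p) (hC : ∀ z w : Z, dist z w ≤ C)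
    (hf : LipschitzWith K f) (hX : Measurable ωX) (hY : Measurable ωY)
    (π : Measure (X × Y)) [IsProbabilityMeasure π] :
    dis p (f ∘ ωX) (f ∘ ωY) π ≤ K * dis p ωX ωY π := by
  have hid := memLp_distortionFun_comp hC LipschitzWith.id hX hY (ENNReal.ofReal p) (π.prod π)
  have hcomp := memLp_distortionFun_comp hC hf hX hY (ENNReal.ofReal p) (π.prod π)
  simp only [Function.id_comp] at hid
  rw [dis_eq_lpNorm hp hcomp, dis_eq_lpNorm hp hid]
  have hsmul := lpNorm_const_smul (K : ℝ) (distortionFun ωX ωY) (p := ENNReal.ofReal p) (π.prod π)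
  rw [show ((‖(K : ℝ)‖₊ : NNReal) : ℝ) = K by simp] at hsmul
  rw [← hsmul]
  refine lpNorm_mono_real (hid.const_smul _) fun v => ?_
  rw [distortionFun, Real.norm_of_nonneg dist_nonneg]
  exact hf.dist_le_mul _ _

theorem dis_le_dis_comp_add {p : ℝ} (hp : 1 ≤ p) (hC : ∀ z w : Z, dist z w ≤ C)
    (hf : LipschitzWith K f) (hX : Measurable ωX) (hY : Measurable ωY) {ε : ℝ} (hε : 0 ≤ ε)
    (h : ∀ z w, dist z w ≤ dist (f z) (f w) + ε)
    (π : Measure (X × Y)) [IsProbabilityMeasure π] :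
    dis p ωX ωY π ≤ dis p (f ∘ ωX) (f ∘ ωY) π + ε := by
  have hid := memLp_distortionFun_comp hC LipschitzWith.id hX hY (ENNReal.ofReal p) (π.prod π)
  have hcomp := memLp_distortionFun_comp hC hf hX hY (ENNReal.ofReal p) (π.prod π)
  simp only [Function.id_comp] at hid
  rw [dis_eq_lpNorm hp hcomp, dis_eq_lpNorm hp hid]
  have hp0 : ENNReal.ofReal p ≠ 0 := by simp; linarith
  have hconst : lpNorm (fun _ => ε) (ENNReal.ofReal p) (π.prod π) = ε := by
    simp [lpNorm_const' hp0, abs_of_nonneg hε]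
  calc lpNorm (distortionFun ωX ωY) (ENNReal.ofReal p) (π.prod π)
      ≤ lpNorm (distortionFun (f ∘ ωX) (f ∘ ωY) + fun _ => ε) (ENNReal.ofReal p) (π.prod π) := by
        refine lpNorm_mono_real (hcomp.add (memLp_const ε)) fun v => ?_
        rw [distortionFun, Real.norm_of_nonneg dist_nonneg]
        exact h _ _
    _ ≤ _ := (lpNorm_add_le hcomp (by simpa using hp)).trans_eq (by rw [hconst])

theorem GW_comp_le_mul {p : ℝ} (hp : 1 ≤ p) (hC : ∀ z w : Z, dist z w ≤ C)
    (hf : LipschitzWith K f) (hX : Measurable ωX) (hY : Measurable ωY)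
    (μX : Measure X) (μY : Measure Y) [IsProbabilityMeasure μX] [IsProbabilityMeasure μY] :
    GW p (f ∘ ωX) μX (f ∘ ωY) μY ≤ K * GW p ωX μX ωY μY := by
  have key : sInf (dis p (f ∘ ωX) (f ∘ ωY) '' Couplings μX μY)
      ≤ K * sInf (dis p ωX ωY '' Couplings μX μY) := by
    rw [← smul_eq_mul, ← Real.sInf_smul_of_nonneg (NNReal.coe_nonneg K)]
    refine le_csInf ((Couplings.nonempty μX μY).image _).smul_set ?_
    rintro _ ⟨_, ⟨π, hπ, rfl⟩, rfl⟩
    have := hπ.1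
    exact (csInf_le (bddBelow_dis_image _ _ _ _) ⟨π, hπ, rfl⟩).trans
      (dis_comp_le_mul hp hC hf hX hY π)
  unfold GW
  linarith

theorem GW_le_GW_comp_add {p : ℝ} (hp : 1 ≤ p) (hC : ∀ z w : Z, dist z w ≤ C)
    (hf : LipschitzWith K f) (hX : Measurable ωX) (hY : Measurable ωY) {ε : ℝ} (hε : 0 ≤ ε)
    (h : ∀ z w, dist z w ≤ dist (f z) (f w) + 2 * ε)
    (μX : Measure X) (μY : Measure Y) [IsProbabilityMeasure μX] [IsProbabilityMeasure μY] :
    GW p ωX μX ωY μY ≤ GW p (f ∘ ωX) μX (f ∘ ωY) μY + ε := by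
  have key : sInf (dis p ωX ωY '' Couplings μX μY) - 2 * ε
      ≤ sInf (dis p (f ∘ ωX) (f ∘ ωY) '' Couplings μX μY) := by
    refine le_csInf ((Couplings.nonempty μX μY).image _) ?_
    rintro _ ⟨π, hπ, rfl⟩
    have := hπ.1
    have hinf := csInf_le (bddBelow_dis_image p ωX ωY _) ⟨π, hπ, rfl⟩
    linarith [dis_le_dis_comp_add hp hC hf hX hY (by positivity) h π]
  unfold GW
  linarith

end Distortion

/-- **Approximation of `Z`-GW by `ℝⁿ`-GW**: for a bounded separable metric space `Z`,
landmarks `Q = (q₁, …, q_n)` in `Z`, and `ℝⁿ` carrying the `ℓ^r` metric (`r ∈ [1,∞]`,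
modeled by `PiLp r`), the `ℝⁿ`-GW distance between the induced networks
`X_Q`, `Y_Q` (with kernels `(x,x') ↦ (d_Z(ω_X(x,x'), q_i))_i`) satisfies
`n^{-1/r} · GW_p^{ℝⁿ}(X_Q, Y_Q) ≤ GW_p^Z(X,Y) ≤ GW_p^{ℝⁿ}(X_Q, Y_Q) + H(Z,Q)`,
where `H(Z,Q) = sup_z min_i d_Z(z, q_i)` is the Hausdorff distance between `Z` and `Q`
(and `n^{-1/∞} = 1`, via `(∞ : ℝ≥0∞).toReal = 0`). -/
theorem gw_approx_by_Rn
    {X Y Z : Type*}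
    [MeasurableSpace X] [TopologicalSpace X] [PolishSpace X] [BorelSpace X]
    [MeasurableSpace Y] [TopologicalSpace Y] [PolishSpace Y] [BorelSpace Y]
    [MetricSpace Z] [MeasurableSpace Z] [BorelSpace Z] [TopologicalSpace.SeparableSpace Z]
    (p : ℝ) (hp : 1 ≤ p) (n : ℕ) (hn : 1 ≤ n)
    (r : ENNReal) [Fact (1 ≤ r)]
    (hbdd : Bornology.IsBounded (Set.univ : Set Z))
    (Q : Fin n → Z)
    (ωX : X × X → Z) (μX : Measure X) (hX : IsNetwork p ωX μX)
    (ωY : Y × Y → Z) (μY : Measure Y) (hY : IsNetwork p ωY μY) :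
    (n : ℝ) ^ (-(1 / r.toReal)) *
        GW p (fun q => (WithLp.equiv r (Fin n → ℝ)).symm fun i => dist (ωX q) (Q i)) μX
             (fun q => (WithLp.equiv r (Fin n → ℝ)).symm fun i => dist (ωY q) (Q i)) μY
      ≤ GW p ωX μX ωY μY ∧
    GW p ωX μX ωY μY ≤
      GW p (fun q => (WithLp.equiv r (Fin n → ℝ)).symm fun i => dist (ωX q) (Q i)) μX
           (fun q => (WithLp.equiv r (Fin n → ℝ)).symm fun i => dist (ωY q) (Q i)) μY
        + ⨆ z : Z, ⨅ i : Fin n, dist z (Q i) := by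
  have := hX.prob
  have := hY.prob
  have : Nonempty (Fin n) := ⟨⟨0, hn⟩⟩
  have := UniformSpace.secondCountable_of_separable Z
  obtain ⟨C, hC⟩ := Metric.isBounded_iff.1 hbdd
  replace hC : ∀ z w : Z, dist z w ≤ C := fun z w => hC trivial trivial
  have hf := lipschitzWith_landmarkEmbedding r Q
  have hn0 : (0 : ℝ) < n := by exact_mod_cast hn
  constructor
  · have h := GW_comp_le_mul hp hC hf hX.meas hY.meas μX μY
    rw [Real.rpow_neg hn0.le, inv_mul_le_iff₀ (by positivity)]
    simpa [landmarkEmbedding, Function.comp_def] using h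
  · exact GW_le_GW_comp_add hp hC hf hX.meas hY.meas
      (Real.iSup_nonneg fun _ => Real.iInf_nonneg fun _ => dist_nonneg)
      (dist_le_dist_landmarkEmbedding_add r Q hC) μX μY
end
end
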